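/- arXiv:2409.02388 — 3 statements merged into one kernel-verified Lean document; each statement's English description precedes it below -/
import Mathlib

section
/- Let p_X be the Gaussian distribution N(μ_X, σ_X²) with σ_X > 0, and let R, R_c ∈ [0,∞]. Then the map P ↦ D(R,R_c,P|φ_KL) is continuous on [0,∞], i.e., it is continuous at every P ∈ [0,∞) and lim_{P→∞} D(R,R_c,P|φ_KL) = D(R,R_c,∞|φ_KL). -/
open MeasureTheory ProbabilityTheory Real Set
open scoped ENNReal NNReal

noncomputable section

open Classical in
/-- Kullback-Leibler divergence of `q` from `p`, in `[0,∞]`. -/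
def KLD {α : Type*} [MeasurableSpace α] (q p : Measure α) : ℝ≥0∞ :=
  if q ≪ p ∧ Integrable (fun x => Real.log (q.rnDeriv p x).toReal) q
  then ENNReal.ofReal (∫ x, Real.log (q.rnDeriv p x).toReal ∂q) else ⊤

/-- Mutual information between `f` and `g` under `μ`. -/
def mutInfo {Ω α β : Type*} [MeasurableSpace Ω] [MeasurableSpace α] [MeasurableSpace β]
    (μ : Measure Ω) (f : Ω → α) (g : Ω → β) : ℝ≥0∞ :=
  KLD (μ.map (fun ω => (f ω, g ω))) ((μ.map f).prod (μ.map g))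

/-- Squared Wasserstein-2 distance. -/
def W2sq (p q : Measure ℝ) : ℝ≥0∞ :=
  ⨅ (cpl : Measure (ℝ × ℝ)) (_ : IsProbabilityMeasure cpl) (_ : cpl.map Prod.fst = p)
    (_ : cpl.map Prod.snd = q), ∫⁻ xy, ENNReal.ofReal ((xy.1 - xy.2) ^ 2) ∂cpl

/-- `exp(-x)` for `x ∈ [0,∞]`, with `exp(-∞) = 0`. -/
def expNeg (x : ℝ≥0∞) : ℝ := if x = ⊤ then 0 else Real.exp (-x.toReal)

/-- Feasibility predicate for the distortion-rate-perception function. -/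
def DRPfeasible (pX : Measure ℝ) (φ : Measure ℝ → Measure ℝ → ℝ≥0∞) (R Rc P : ℝ≥0∞)
    (μ : Measure (ℝ × ℝ × ℝ)) : Prop :=
  ∃ hμ : IsProbabilityMeasure μ,
    μ.map (fun w => w.1) = pX ∧
    (haveI := hμ
     CondIndepFun (MeasurableSpace.comap (fun w : ℝ × ℝ × ℝ => w.2.1) inferInstance)
      ((measurable_fst.comp measurable_snd).comap_le)
      (fun w : ℝ × ℝ × ℝ => w.1) (fun w : ℝ × ℝ × ℝ => w.2.2) μ) ∧
    mutInfo μ (fun w => w.1) (fun w => w.2.1) ≤ R ∧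
    mutInfo μ (fun w => w.2.2) (fun w => w.2.1) ≤ R + Rc ∧
    φ pX (μ.map (fun w => w.2.2)) ≤ P

/-- Mean squared distortion of a joint law of `(X, U, X̂)`. -/
def distortion (μ : Measure (ℝ × ℝ × ℝ)) : ℝ≥0∞ :=
  ∫⁻ w, ENNReal.ofReal ((w.1 - w.2.2) ^ 2) ∂μ

/-- The distortion-rate-perception function `D(R, R_c, P | φ)`. -/
def DRP (pX : Measure ℝ) (φ : Measure ℝ → Measure ℝ → ℝ≥0∞) (R Rc P : ℝ≥0∞) : ℝ≥0∞ :=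
  ⨅ (μ : Measure (ℝ × ℝ × ℝ)) (_ : DRPfeasible pX φ R Rc P μ), distortion μ

/-- `D(R, R_c, ∞)`: the DRP function without perception constraint. -/
def DRPinf (pX : Measure ℝ) (R Rc : ℝ≥0∞) : ℝ≥0∞ :=
  DRP pX (fun _ _ => 0) R Rc ⊤

/-- Deterministic-decoder (entropy-constrained quantization) function `D_e(R, R_c)`,
with `H(X̂) := I(X̂; X̂)`. -/
def De (pX : Measure ℝ) (R Rc : ℝ≥0∞) : ℝ≥0∞ :=
  ⨅ (cpl : Measure (ℝ × ℝ)) (_ : IsProbabilityMeasure cpl ∧ cpl.map Prod.fst = pX ∧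
      mutInfo cpl Prod.fst Prod.snd ≤ R ∧ mutInfo cpl Prod.snd Prod.snd ≤ R + Rc),
    ∫⁻ w, ENNReal.ofReal ((w.1 - w.2) ^ 2) ∂cpl

/-- The Gaussian measure `N(μ, σ²)`. -/
def gauss (μ σ : ℝ) : Measure ℝ := gaussianReal μ ⟨σ ^ 2, sq_nonneg σ⟩

end
noncomputable section

/-- `ξ(R, R_c) = √((1 - e^{-2R})(1 - e^{-2(R+R_c)}))`. -/
def xiRRc (R Rc : ℝ≥0∞) : ℝ :=
  Real.sqrt ((1 - expNeg (2 * R)) * (1 - expNeg (2 * (R + Rc))))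

/-- `ψ(σ) = log(σ_X/σ) + (σ² - σ_X²)/(2σ_X²)`. -/
def psi (σX s : ℝ) : ℝ := Real.log (σX / s) + (s ^ 2 - σX ^ 2) / (2 * σX ^ 2)

/-- `δ₊(σ̂, α)` from the improved lower bound. -/
def deltaPlus (σX : ℝ) (R Rc : ℝ≥0∞) (P s α : ℝ) : ℝ :=
  max (σX * expNeg (R + Rc) -
    Real.sqrt (σX ^ 2 - α * (σX ^ 2 + s ^ 2 - P) + α ^ 2 * s ^ 2)) 0 / α

/-- The inner `sup` over `α > 0` in the improved lower bound `D̲'`. -/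
def DlowerPrimeFun (σX : ℝ) (R Rc : ℝ≥0∞) (P s : ℝ) : ℝ :=
  sSup ((fun α => σX ^ 2 + s ^ 2 - 2 * σX *
    Real.sqrt ((1 - expNeg (2 * R)) * (s ^ 2 - deltaPlus σX R Rc P s α ^ 2))) '' Set.Ioi 0)

/-- The improved explicit lower bound `D̲'(R, R_c, P | W₂²)`. -/
def DlowerPrime (σX : ℝ) (R Rc : ℝ≥0∞) (P : ℝ) : ℝ :=
  sInf (DlowerPrimeFun σX R Rc P '' Set.Icc (max (σX - Real.sqrt P) 0) σX)

/-- The explicit lower bound `D̲(R, R_c, P | W₂²)` of Xie et al. -/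
def DlowerW2 (σX : ℝ) (R Rc : ℝ≥0∞) (P : ℝ) : ℝ :=
  sInf ((fun s => σX ^ 2 + s ^ 2 - 2 * σX *
      Real.sqrt ((1 - expNeg (2 * R)) *
        (s ^ 2 - max (σX * expNeg (R + Rc) - Real.sqrt P) 0 ^ 2)))
    '' Set.Icc (max (σX - Real.sqrt P) 0) σX)

end

open InformationTheory

lemma KLD_eq_klDiv {α : Type*} [MeasurableSpace α] (q p : Measure α)
    [IsProbabilityMeasure q] [IsProbabilityMeasure p] : KLD q p = klDiv q p := by
  rw [klDiv_def]
  unfold KLD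
  simp [llr_def]
  congr

lemma condIndep_of_kernels (μ : Measure (ℝ × ℝ × ℝ)) [IsProbabilityMeasure μ]
    (κ₁ κ₂ : Kernel ℝ ℝ) [IsMarkovKernel κ₁] [IsMarkovKernel κ₂]
    (h : ∀ s t u : Set ℝ, MeasurableSet s → MeasurableSet t → MeasurableSet u →
      μ (t ×ˢ s ×ˢ u) = ∫⁻ k in s, κ₁ k t * κ₂ k u ∂(μ.map (fun w => w.2.1))) :
    CondIndepFun (MeasurableSpace.comap (fun w : ℝ × ℝ × ℝ => w.2.1) inferInstance)
      ((measurable_fst.comp measurable_snd).comap_le)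
      (fun w : ℝ × ℝ × ℝ => w.1) (fun w : ℝ × ℝ × ℝ => w.2.2) μ := by
  have hk : Measurable (fun w : ℝ × ℝ × ℝ => w.2.1) := by fun_prop
  have : IsProbabilityMeasure (μ.map (fun w => w.2.1)) :=
    Measure.isProbabilityMeasure_map hk.aemeasurable
  have h1 : condDistrib (fun w : ℝ × ℝ × ℝ => w.1) (fun w => w.2.1) μ
      =ᵐ[μ.map (fun w => w.2.1)] κ₁ := by
    apply condDistrib_ae_eq_of_measure_eq_compProd_of_measurable hk (by fun_prop)
    apply Measure.ext_prod
    intro s t hs ht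
    rw [Measure.compProd_apply_prod hs ht, Measure.map_apply (by fun_prop) (hs.prod ht)]
    have := h s t univ hs ht .univ
    simp only [measure_univ, mul_one] at this
    rw [← this]
    congr 1
    ext w; simp; tauto
  have h2 : condDistrib (fun w : ℝ × ℝ × ℝ => w.2.2) (fun w => w.2.1) μ
      =ᵐ[μ.map (fun w => w.2.1)] κ₂ := by
    apply condDistrib_ae_eq_of_measure_eq_compProd_of_measurable hk (by fun_prop)
    apply Measure.ext_prod
    intro s t hs ht
    rw [Measure.compProd_apply_prod hs ht, Measure.map_apply (by fun_prop) (hs.prod ht)]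
    have := h s univ t hs .univ ht
    simp only [measure_univ, one_mul] at this
    rw [← this]
    congr 1
    ext w; simp
  refine (condIndepFun_iff_map_prod_eq_prod_condDistrib_prod_condDistrib
    (by fun_prop) (by fun_prop) hk).2 ?_
  rw [Measure.ext_prod₃_iff]
  intro s t u hs ht hu
  rw [Measure.map_apply (by fun_prop) (hs.prod (ht.prod hu)),
    Measure.bind_apply (hs.prod (ht.prod hu)) (by fun_prop)]
  have : (fun w : ℝ × ℝ × ℝ => (w.2.1, w.1, w.2.2)) ⁻¹' (s ×ˢ t ×ˢ u) = t ×ˢ s ×ˢ u := by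
    ext w; simp; tauto
  rw [this, h s t u hs ht hu, ← lintegral_indicator hs]
  refine lintegral_congr_ae ?_
  filter_upwards [h1, h2] with k hk1 hk2
  simp only [Kernel.prod_apply_prod, Kernel.id_apply, Measure.dirac_apply' _ hs, hk1, hk2]
  by_cases hks : k ∈ s <;> simp [hks]

lemma lintegral_of_condIndep (μ : Measure (ℝ × ℝ × ℝ)) [IsProbabilityMeasure μ]
    (h : CondIndepFun (MeasurableSpace.comap (fun w : ℝ × ℝ × ℝ => w.2.1) inferInstance)
      ((measurable_fst.comp measurable_snd).comap_le)
      (fun w : ℝ × ℝ × ℝ => w.1) (fun w : ℝ × ℝ × ℝ => w.2.2) μ) :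
    ∃ κ₁ κ₂ : Kernel ℝ ℝ, IsMarkovKernel κ₁ ∧ IsMarkovKernel κ₂ ∧
      ∀ (s t : Set ℝ) (f : ℝ → ℝ≥0∞), MeasurableSet s → MeasurableSet t → Measurable f →
      ∫⁻ w, (t ×ˢ s).indicator 1 (w.1, w.2.1) * f w.2.2 ∂μ
        = ∫⁻ k in s, κ₁ k t * ∫⁻ y, f y ∂(κ₂ k) ∂(μ.map (fun w => w.2.1)) := by
  have hk : Measurable (fun w : ℝ × ℝ × ℝ => w.2.1) := by fun_prop
  have h' := (condIndepFun_iff_map_prod_eq_prod_condDistrib_prod_condDistrib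
    (by fun_prop) (by fun_prop) hk).1 h
  refine ⟨condDistrib (fun w : ℝ × ℝ × ℝ => w.1) (fun w => w.2.1) μ,
    condDistrib (fun w : ℝ × ℝ × ℝ => w.2.2) (fun w => w.2.1) μ, inferInstance, inferInstance, ?_⟩
  intro s t f hs ht hf
  set F : ℝ × ℝ × ℝ → ℝ≥0∞ := fun v => s.indicator 1 v.1 * (t.indicator 1 v.2.1 * f v.2.2) with hF
  have hFm : Measurable F := by
    have h1 : Measurable (s.indicator (1 : ℝ → ℝ≥0∞)) := measurable_one.indicator hs
    have h2 : Measurable (t.indicator (1 : ℝ → ℝ≥0∞)) := measurable_one.indicator ht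
    exact (h1.comp measurable_fst).mul ((h2.comp (by fun_prop)).mul (hf.comp (by fun_prop)))
  have e1 : ∫⁻ w, (t ×ˢ s).indicator 1 (w.1, w.2.1) * f w.2.2 ∂μ
      = ∫⁻ v, F v ∂(μ.map (fun w => (w.2.1, w.1, w.2.2))) := by
    rw [lintegral_map hFm (by fun_prop)]
    refine lintegral_congr fun w => ?_
    simp only [hF, Set.indicator, Set.mem_prod, Pi.one_apply]
    by_cases h1 : w.1 ∈ t <;> by_cases h2 : w.2.1 ∈ s <;> simp [h1, h2]
  rw [e1, h', Measure.lintegral_bind (by fun_prop) hFm.aemeasurable, ← lintegral_indicator hs]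
  refine lintegral_congr fun k => ?_
  rw [Kernel.prod_apply, Kernel.prod_apply, Kernel.id_apply,
    lintegral_prod _ hFm.aemeasurable, lintegral_dirac']
  · simp only [hF]
    rw [lintegral_const_mul, lintegral_prod_mul]
    · rw [lintegral_indicator_one ht]
      by_cases hks : k ∈ s <;> simp [hks]
    · exact (measurable_one.indicator ht).aemeasurable
    · exact hf.aemeasurable
    · exact ((measurable_one.indicator ht).comp measurable_fst).mul (hf.comp measurable_snd)
  · exact hFm.lintegral_prod_right'

/-- Replace `X̂` by a noisy version obtained through the kernel `κ`. -/
noncomputable def modLaw (μ : Measure (ℝ × ℝ × ℝ)) (κ : Kernel ℝ ℝ) : Measure (ℝ × ℝ × ℝ) :=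
  (μ ⊗ₘ (κ.comap (fun w : ℝ × ℝ × ℝ => w.2.2) (by fun_prop))).map
    (fun p => (p.1.1, p.1.2.1, p.2))

lemma lintegral_modLaw (μ : Measure (ℝ × ℝ × ℝ)) [IsProbabilityMeasure μ] (κ : Kernel ℝ ℝ)
    [IsMarkovKernel κ] (F : ℝ × ℝ × ℝ → ℝ≥0∞) (hF : Measurable F) :
    ∫⁻ v, F v ∂(modLaw μ κ) = ∫⁻ w, ∫⁻ y, F (w.1, w.2.1, y) ∂(κ w.2.2) ∂μ := by
  unfold modLaw
  rw [lintegral_map hF (by fun_prop), Measure.lintegral_compProd (by fun_prop)]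
  rfl

instance (μ : Measure (ℝ × ℝ × ℝ)) [IsProbabilityMeasure μ] (κ : Kernel ℝ ℝ)
    [IsMarkovKernel κ] : IsProbabilityMeasure (modLaw μ κ) := by
  unfold modLaw
  exact Measure.isProbabilityMeasure_map (by fun_prop)

lemma map_modLaw_fst (μ : Measure (ℝ × ℝ × ℝ)) [IsProbabilityMeasure μ] (κ : Kernel ℝ ℝ)
    [IsMarkovKernel κ] {β : Type*} [MeasurableSpace β] (g : ℝ × ℝ → β) (hg : Measurable g) :
    (modLaw μ κ).map (fun w => g (w.1, w.2.1)) = μ.map (fun w => g (w.1, w.2.1)) := by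
  have : μ = (μ ⊗ₘ (κ.comap (fun w : ℝ × ℝ × ℝ => w.2.2) (by fun_prop))).map Prod.fst := by
    rw [← Measure.fst, Measure.fst_compProd]
  conv_rhs => rw [this]
  unfold modLaw
  rw [Measure.map_map (by fun_prop) (by fun_prop), Measure.map_map (by fun_prop) (by fun_prop)]
  rfl

lemma map_modLaw_snd (μ : Measure (ℝ × ℝ × ℝ)) [IsProbabilityMeasure μ] (κ : Kernel ℝ ℝ)
    [IsMarkovKernel κ] :
    (modLaw μ κ).map (fun w => (w.2.2, w.2.1)) =
      (κ ∥ₖ Kernel.id) ∘ₘ (μ.map (fun w => (w.2.2, w.2.1))) := by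
  apply Measure.ext_of_lintegral
  intro f hf
  rw [lintegral_map hf (by fun_prop), lintegral_modLaw _ _ _ (by fun_prop),
    Measure.lintegral_bind (by fun_prop) hf.aemeasurable, lintegral_map _ (by fun_prop)]
  · refine lintegral_congr fun w => ?_
    rw [Kernel.parallelComp_apply, Kernel.id_apply, lintegral_prod _ hf.aemeasurable]
    refine lintegral_congr fun y => ?_
    rw [lintegral_dirac' _ (by fun_prop)]
  · exact hf.lintegral_kernel

lemma map_modLaw_out (μ : Measure (ℝ × ℝ × ℝ)) [IsProbabilityMeasure μ] (κ : Kernel ℝ ℝ)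
    [IsMarkovKernel κ] :
    (modLaw μ κ).map (fun w => w.2.2) = κ ∘ₘ (μ.map (fun w => w.2.2)) := by
  apply Measure.ext_of_lintegral
  intro f hf
  rw [lintegral_map hf (by fun_prop), lintegral_modLaw _ _ _ (by fun_prop),
    Measure.lintegral_bind (by fun_prop) hf.aemeasurable, lintegral_map _ (by fun_prop)]
  exact hf.lintegral_kernel

lemma feasible_modLaw {pX : Measure ℝ} {R Rc P P' : ℝ≥0∞} {μ : Measure (ℝ × ℝ × ℝ)}
    {φ : Measure ℝ → Measure ℝ → ℝ≥0∞}
    (h : DRPfeasible pX φ R Rc P μ) (κ : Kernel ℝ ℝ) [IsMarkovKernel κ]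
    (hP : φ pX (κ ∘ₘ (μ.map (fun w => w.2.2))) ≤ P') :
    DRPfeasible pX φ R Rc P' (modLaw μ κ) := by
  obtain ⟨hμ, hX, hCI, h1, h2, -⟩ := h
  have pr {β : Type} [MeasurableSpace β] (ν : Measure (ℝ × ℝ × ℝ)) [IsProbabilityMeasure ν]
    {g : ℝ × ℝ × ℝ → β} (hg : Measurable g) :
    IsProbabilityMeasure (ν.map g) := Measure.isProbabilityMeasure_map hg.aemeasurable
  have mU : (modLaw μ κ).map (fun w => w.2.1) = μ.map (fun w => w.2.1) :=
    map_modLaw_fst μ κ (fun p => p.2) (by fun_prop)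
  have mX : (modLaw μ κ).map (fun w => w.1) = μ.map (fun w => w.1) :=
    map_modLaw_fst μ κ (fun p => p.1) (by fun_prop)
  have mXU : (modLaw μ κ).map (fun w => (w.1, w.2.1)) = μ.map (fun w => (w.1, w.2.1)) :=
    map_modLaw_fst μ κ (fun p => p) (by fun_prop)
  refine ⟨inferInstance, ?_, ?_, ?_, ?_, ?_⟩
  · rw [mX, hX]
  · obtain ⟨κ₁, κ₂, i1, i2, hκ⟩ := lintegral_of_condIndep μ hCI
    apply condIndep_of_kernels _ κ₁ (κ ∘ₖ κ₂)
    intro s t u hs ht hu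
    rw [mU]
    have hm : Measurable (fun y => κ y u) := Kernel.measurable_coe κ hu
    have := hκ s t (fun y => κ y u) hs ht hm
    simp_rw [Kernel.comp_apply' _ _ _ hu]
    rw [← this, ← lintegral_indicator_one (ht.prod (hs.prod hu)), lintegral_modLaw]
    · refine lintegral_congr fun w => ?_
      by_cases hw : (w.1, w.2.1) ∈ t ×ˢ s
      · rw [Set.indicator_of_mem hw]
        simp only [Pi.one_apply, one_mul]
        rw [← lintegral_indicator_one hu]
        refine lintegral_congr fun y => ?_
        simp only [Set.mem_prod] at hw
        by_cases hy : y ∈ u <;> simp [hy, hw.1, hw.2]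
      · rw [Set.indicator_of_notMem hw, zero_mul]
        simp only [Set.mem_prod] at hw
        have : ∀ y, (t ×ˢ s ×ˢ u).indicator (1 : ℝ × ℝ × ℝ → ℝ≥0∞) (w.1, w.2.1, y) = 0 := by
          intro y
          apply Set.indicator_of_notMem
          simp only [Set.mem_prod]; tauto
        simp [this]
    · exact measurable_one.indicator (ht.prod (hs.prod hu))
  · unfold mutInfo at h1 ⊢
    rw [mXU, mX, mU]; exact h1
  · refine le_trans ?_ h2
    unfold mutInfo
    rw [map_modLaw_snd, map_modLaw_out, mU]
    have := pr μ (g := fun w => (w.2.2, w.2.1)) (by fun_prop)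
    have := pr μ (g := fun w => w.2.2) (by fun_prop)
    have := pr μ (g := fun w => w.2.1) (by fun_prop)
    rw [KLD_eq_klDiv, KLD_eq_klDiv, Measure.prod_comp_left]
    exact klDiv_comp_right_le _ _ _
  · rwa [map_modLaw_out]

lemma ofReal_sq_le (a b η : ℝ) (hη : 0 < η) :
    ENNReal.ofReal ((a + b) ^ 2) ≤ ENNReal.ofReal (1 + η) * ENNReal.ofReal (a ^ 2)
      + ENNReal.ofReal (1 + 1 / η) * ENNReal.ofReal (b ^ 2) := by
  rw [← ENNReal.ofReal_mul (by positivity), ← ENNReal.ofReal_mul (by positivity),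
    ← ENNReal.ofReal_add (by positivity) (by positivity)]
  apply ENNReal.ofReal_le_ofReal
  have : (1 + η) * a ^ 2 + (1 + 1 / η) * b ^ 2 - (a + b) ^ 2 = (η * a - b) ^ 2 / η := by
    field_simp; ring
  have h2 : 0 ≤ (η * a - b) ^ 2 / η := by positivity
  linarith

lemma distortion_modLaw (μ : Measure (ℝ × ℝ × ℝ)) [IsProbabilityMeasure μ] (κ : Kernel ℝ ℝ)
    [IsMarkovKernel κ] (η : ℝ) (hη : 0 < η) :
    distortion (modLaw μ κ) ≤ ENNReal.ofReal (1 + η) * distortion μ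
      + ENNReal.ofReal (1 + 1 / η) *
        ∫⁻ x, ∫⁻ y, ENNReal.ofReal ((x - y) ^ 2) ∂(κ x) ∂(μ.map (fun w => w.2.2)) := by
  unfold distortion
  have hm : Measurable (fun x : ℝ => ∫⁻ y, ENNReal.ofReal ((x - y) ^ 2) ∂(κ x)) := by
    apply Measurable.lintegral_kernel_prod_right' (f := fun p : ℝ × ℝ => ENNReal.ofReal ((p.1 - p.2) ^ 2))
    fun_prop
  have hm2 : Measurable (fun w : ℝ × ℝ × ℝ => ∫⁻ y, ENNReal.ofReal ((w.2.2 - y) ^ 2) ∂(κ w.2.2)) :=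
    hm.comp (by fun_prop : Measurable fun w : ℝ × ℝ × ℝ => w.2.2)
  rw [lintegral_modLaw _ _ _ (by fun_prop), lintegral_map hm (by fun_prop),
    ← lintegral_const_mul _ (by fun_prop),
    ← lintegral_const_mul _ hm2,
    ← lintegral_add_left (by fun_prop)]
  refine lintegral_mono fun w => ?_
  dsimp only
  rw [← lintegral_const_mul _ (by fun_prop)]
  have : ENNReal.ofReal (1 + η) * ENNReal.ofReal ((w.1 - w.2.2) ^ 2) =
    ∫⁻ y, ENNReal.ofReal (1 + η) * ENNReal.ofReal ((w.1 - w.2.2) ^ 2) ∂(κ w.2.2) := by simp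
  rw [this, ← lintegral_add_left (by fun_prop)]
  refine lintegral_mono fun y => ?_
  have := ofReal_sq_le (w.1 - w.2.2) (w.2.2 - y) η hη
  simpa using this

/-- Main perturbation lemma. -/
lemma perturb {pX : Measure ℝ} {R Rc P P' : ℝ≥0∞} {μ : Measure (ℝ × ℝ × ℝ)}
    (h : DRPfeasible pX (fun p q => KLD q p) R Rc P μ)
    (cp : Measure (ℝ × ℝ)) [IsProbabilityMeasure cp]
    (hcp : cp.fst = μ.map (fun w => w.2.2)) (hP : KLD cp.snd pX ≤ P') (η : ℝ) (hη : 0 < η) :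
    DRP pX (fun p q => KLD q p) R Rc P' ≤ ENNReal.ofReal (1 + η) * distortion μ
      + ENNReal.ofReal (1 + 1 / η) * ∫⁻ z, ENNReal.ofReal ((z.1 - z.2) ^ 2) ∂cp := by
  have := h.1
  have e : cp.fst ⊗ₘ cp.condKernel = cp := Measure.disintegrate cp cp.condKernel
  have h2 : cp.condKernel ∘ₘ (μ.map (fun w => w.2.2)) = cp.snd := by
    rw [← hcp]
    conv_rhs => rw [← e]
    rw [Measure.snd_compProd]
  have hf := feasible_modLaw (P' := P') h cp.condKernel (by rw [h2]; exact hP)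
  refine (iInf₂_le _ hf).trans ((distortion_modLaw μ _ η hη).trans ?_)
  gcongr
  rw [← hcp]
  conv_rhs => rw [← e]
  rw [Measure.lintegral_compProd (by fun_prop)]

/-- second moment -/
noncomputable def sm (ν : Measure ℝ) : ℝ≥0∞ := ∫⁻ x, ENNReal.ofReal (x ^ 2) ∂ν

lemma ofReal_sub_sq_le (a b : ℝ) :
    ENNReal.ofReal ((a - b) ^ 2) ≤ 2 * ENNReal.ofReal (a ^ 2) + 2 * ENNReal.ofReal (b ^ 2) := by
  have := ofReal_sq_le a (-b) 1 one_pos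
  have e : (1 : ℝ) + 1 = 2 := by norm_num
  simpa [e, sub_eq_add_neg] using this

lemma cost_le_sm (π' : Measure (ℝ × ℝ)) :
    ∫⁻ z, ENNReal.ofReal ((z.1 - z.2) ^ 2) ∂π' ≤ 2 * sm π'.fst + 2 * sm π'.snd := by
  unfold sm Measure.fst Measure.snd
  rw [lintegral_map (by fun_prop) (by fun_prop), lintegral_map (by fun_prop) (by fun_prop),
    ← lintegral_const_mul _ (by fun_prop), ← lintegral_const_mul _ (by fun_prop),
    ← lintegral_add_left (by fun_prop)]
  exact lintegral_mono fun z => ofReal_sub_sq_le _ _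

lemma sm_le_cost (π' : Measure (ℝ × ℝ)) :
    sm π'.snd ≤ 2 * sm π'.fst + 2 * ∫⁻ z, ENNReal.ofReal ((z.1 - z.2) ^ 2) ∂π' := by
  unfold sm Measure.fst Measure.snd
  rw [lintegral_map (by fun_prop) (by fun_prop), lintegral_map (by fun_prop) (by fun_prop),
    ← lintegral_const_mul _ (by fun_prop), ← lintegral_const_mul _ (by fun_prop),
    ← lintegral_add_left (by fun_prop)]
  refine lintegral_mono fun z => ?_
  have := ofReal_sub_sq_le z.1 (z.1 - z.2)
  simpa using this

lemma sm_out_le (μ : Measure (ℝ × ℝ × ℝ)) :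
    sm (μ.map (fun w => w.2.2)) ≤ 2 * sm (μ.map (fun w => w.1)) + 2 * distortion μ := by
  have := sm_le_cost (μ.map (fun w => (w.1, w.2.2)))
  rw [Measure.fst, Measure.snd, Measure.map_map (by fun_prop) (by fun_prop),
    Measure.map_map (by fun_prop) (by fun_prop), lintegral_map (by fun_prop) (by fun_prop)] at this
  exact this

lemma klDiv_mix_le (q p : Measure ℝ) [IsProbabilityMeasure q] [IsProbabilityMeasure p]
    (a b : ℝ≥0) (hab : a + b = 1) : klDiv (a • q + b • p) p ≤ a * klDiv q p := by
  by_cases ha : a = 0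
  · subst ha
    have : b = 1 := by simpa using hab
    subst this
    simp
  by_cases hq : q ≪ p
  swap
  · rw [klDiv_of_not_ac hq, ENNReal.mul_top (by simpa using ha)]
    exact le_top
  have hac : a • q + b • p ≪ p :=
    Measure.AbsolutelyContinuous.add_left (hq.smul_left a)
      ((Measure.AbsolutelyContinuous.refl p).smul_left b)
  rw [klDiv_eq_lintegral_klFun_of_ac hac, klDiv_eq_lintegral_klFun_of_ac hq,
    ← lintegral_const_mul _ (by fun_prop)]
  refine lintegral_mono_ae ?_
  filter_upwards [Measure.rnDeriv_add (a • q) (b • p) p, Measure.rnDeriv_smul_left q p a,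
    Measure.rnDeriv_smul_left p p b, Measure.rnDeriv_self p, Measure.rnDeriv_lt_top q p]
    with x h1 h2 h3 h4 h5
  rw [h1, Pi.add_apply, h2, h3, Pi.smul_apply, Pi.smul_apply, h4]
  have e : (a • q.rnDeriv p x + b • (1 : ℝ≥0∞)).toReal
      = (a : ℝ) * (q.rnDeriv p x).toReal + (b : ℝ) * 1 := by
    rw [ENNReal.toReal_add]
    · simp [ENNReal.smul_def]
    · simp only [ENNReal.smul_def, smul_eq_mul]
      exact ENNReal.mul_ne_top (by simp) h5.ne
    · simp [ENNReal.smul_def]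
  rw [e, ← ENNReal.ofReal_coe_nnreal, ← ENNReal.ofReal_mul (by positivity)]
  apply ENNReal.ofReal_le_ofReal
  have := convexOn_klFun.2 (x := (q.rnDeriv p x).toReal) (y := 1) ENNReal.toReal_nonneg
    (by simp) a.coe_nonneg b.coe_nonneg (by exact_mod_cast hab)
  simpa [klFun_one] using this

lemma mix_coupling (q p : Measure ℝ) [IsProbabilityMeasure q] [IsProbabilityMeasure p]
    (a b : ℝ≥0) (hab : a + b = 1) : ∃ cp : Measure (ℝ × ℝ), IsProbabilityMeasure cp ∧
      cp.fst = q ∧ KLD cp.snd p ≤ a * KLD q p ∧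
      ∫⁻ z, ENNReal.ofReal ((z.1 - z.2) ^ 2) ∂cp ≤ b * (2 * sm q + 2 * sm p) := by
  let cp : Measure (ℝ × ℝ) := a • q.map (fun x => (x, x)) + b • q.prod p
  have h1 : cp.fst = q := by
    simp only [cp, Measure.fst]
    rw [Measure.map_add _ _ measurable_fst, Measure.map_smul, Measure.map_smul,
      Measure.map_map (by fun_prop) (by fun_prop), ← Measure.fst, Measure.fst_prod]
    have : (Prod.fst ∘ fun x : ℝ => (x, x)) = id := rfl
    rw [this, Measure.map_id, ← add_smul, hab, one_smul]
  have h2 : cp.snd = a • q + b • p := by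
    simp only [cp, Measure.snd]
    rw [Measure.map_add _ _ measurable_snd, Measure.map_smul, Measure.map_smul,
      Measure.map_map (by fun_prop) (by fun_prop), ← Measure.snd, Measure.snd_prod]
    have : (Prod.snd ∘ fun x : ℝ => (x, x)) = id := rfl
    rw [this, Measure.map_id]
  have h0 : IsProbabilityMeasure cp := by
    constructor
    rw [← Measure.fst_univ, h1, measure_univ]
  refine ⟨cp, h0, h1, ?_, ?_⟩
  · have : IsProbabilityMeasure cp.snd := inferInstance
    rw [KLD_eq_klDiv, KLD_eq_klDiv, h2]
    exact klDiv_mix_le q p a b hab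
  · simp only [cp]
    rw [lintegral_add_measure, lintegral_smul_measure, lintegral_smul_measure,
      lintegral_map (by fun_prop) (by fun_prop)]
    simp only [sub_self, ne_eq, OfNat.ofNat_ne_zero, not_false_eq_true, zero_pow,
      ENNReal.ofReal_zero, lintegral_zero, smul_zero, zero_add]
    rw [ENNReal.smul_def, smul_eq_mul]
    gcongr
    refine (cost_le_sm _).trans ?_
    rw [Measure.fst_prod, Measure.snd_prod]

lemma tv_coupling (q p : Measure ℝ) [IsProbabilityMeasure q] [IsProbabilityMeasure p]
    (hq : q ≪ p) : ∃ cp : Measure (ℝ × ℝ), IsProbabilityMeasure cp ∧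
      cp.fst = q ∧ cp.snd = p ∧
      ∫⁻ z, ENNReal.ofReal ((z.1 - z.2) ^ 2) ∂cp ≤
        2 * ∫⁻ x, ENNReal.ofReal (x ^ 2 * |(q.rnDeriv p x).toReal - 1|) ∂p := by
  set h := q.rnDeriv p with hh
  have hm : Measurable h := Measure.measurable_rnDeriv q p
  let m0 := p.withDensity (fun x => min (h x) 1)
  let q1 := p.withDensity (fun x => h x - 1)
  let p1 := p.withDensity (fun x => 1 - h x)
  have eq : m0 + q1 = q := by
    rw [← Measure.withDensity_rnDeriv_eq q p hq]
    simp only [m0, q1]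
    rw [← withDensity_add_left (by fun_prop)]
    congr 1
    ext x
    simp only [Pi.add_apply]
    rcases le_total (h x) 1 with h1 | h1
    · simp [h1, tsub_eq_zero_of_le h1]
      rfl
    · simp [h1]
      rfl
  have ep : m0 + p1 = p := by
    conv_rhs => rw [← withDensity_one (μ := p)]
    simp only [m0, p1]
    rw [← withDensity_add_left (by fun_prop)]
    congr 1
    ext x
    simp only [Pi.add_apply]
    rcases le_total (h x) 1 with h1 | h1
    · simp [h1]
    · simp [h1, tsub_eq_zero_of_le h1]
  have hm0 : m0 univ ≤ 1 := by
    have := congrArg (fun ν => ν univ) ep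
    simp only [Measure.add_apply, measure_univ] at this
    rw [← this]; exact le_self_add
  have hm0' : m0 univ ≠ ⊤ := ne_top_of_le_ne_top (by simp) hm0
  have hδ : q1 univ = p1 univ := by
    have e1 := congrArg (fun ν => ν univ) eq
    have e2 := congrArg (fun ν => ν univ) ep
    simp only [Measure.add_apply, measure_univ] at e1 e2
    exact (ENNReal.add_right_inj hm0').1 (e1.trans e2.symm)
  have : IsFiniteMeasure q1 := ⟨by
    have : q1 ≤ q := by rw [← eq]; exact Measure.le_add_left le_rfl
    exact (this univ).trans_lt (by simp)⟩
  have : IsFiniteMeasure p1 := ⟨by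
    have : p1 ≤ p := by
      conv_rhs => rw [← ep]
      exact Measure.le_add_left le_rfl
    exact (this univ).trans_lt (by simp)⟩
  set δ := q1 univ with hδdef
  have key : ∃ r : Measure (ℝ × ℝ), r.fst = q1 ∧ r.snd = p1 := by
    by_cases h0 : δ = 0
    · have a1 : q1 = 0 := Measure.measure_univ_eq_zero.1 h0
      have a2 : p1 = 0 := Measure.measure_univ_eq_zero.1 (hδ ▸ h0)
      exact ⟨0, by simp [a1, Measure.fst], by simp [a2, Measure.snd]⟩
    · have ht : δ ≠ ⊤ := measure_ne_top _ _
      refine ⟨δ⁻¹ • q1.prod p1, ?_, ?_⟩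
      · rw [Measure.fst, Measure.map_smul, ← Measure.fst, Measure.fst, Measure.map_fst_prod,
          ← hδ, smul_smul, ENNReal.inv_mul_cancel h0 ht, one_smul]
      · rw [Measure.snd, Measure.map_smul, ← Measure.snd, Measure.snd, Measure.map_snd_prod,
          smul_smul, ENNReal.inv_mul_cancel h0 ht, one_smul]
  obtain ⟨r, hr1, hr2⟩ := key
  let cp : Measure (ℝ × ℝ) := m0.map (fun x => (x, x)) + r
  have h1 : cp.fst = q := by
    simp only [cp, Measure.fst]
    rw [Measure.map_add _ _ measurable_fst, Measure.map_map (by fun_prop) (by fun_prop),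
      ← Measure.fst, hr1]
    have : (Prod.fst ∘ fun x : ℝ => (x, x)) = id := rfl
    rw [this, Measure.map_id, eq]
  have h2 : cp.snd = p := by
    simp only [cp, Measure.snd]
    rw [Measure.map_add _ _ measurable_snd, Measure.map_map (by fun_prop) (by fun_prop),
      ← Measure.snd, hr2]
    have : (Prod.snd ∘ fun x : ℝ => (x, x)) = id := rfl
    rw [this, Measure.map_id, ep]
  have h0 : IsProbabilityMeasure cp := by
    constructor
    rw [← Measure.fst_univ, h1, measure_univ]
  refine ⟨cp, h0, h1, h2, ?_⟩
  simp only [cp]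
  rw [lintegral_add_measure, lintegral_map (by fun_prop) (by fun_prop)]
  simp only [sub_self, ne_eq, OfNat.ofNat_ne_zero, not_false_eq_true, zero_pow,
      ENNReal.ofReal_zero, lintegral_zero, zero_add]
  refine (cost_le_sm r).trans ?_
  rw [hr1, hr2, ← mul_add]
  gcongr
  simp only [sm, q1, p1]
  rw [lintegral_withDensity_eq_lintegral_mul _ (by fun_prop) (by fun_prop),
    lintegral_withDensity_eq_lintegral_mul _ (by fun_prop) (by fun_prop),
    ← lintegral_add_left (by fun_prop)]
  refine lintegral_mono_ae ?_
  filter_upwards [Measure.rnDeriv_lt_top q p] with x hx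
  simp only [Pi.mul_apply]
  rw [← add_mul, mul_comm, ENNReal.ofReal_mul (sq_nonneg x)]
  gcongr
  change h x < ⊤ at hx
  lift h x to ℝ≥0 using hx.ne with y
  rw [ENNReal.coe_toReal]
  rcases le_total y 1 with h1 | h1
  · have h1' : (y : ℝ) ≤ 1 := h1
    have h1'' : (y : ℝ≥0∞) ≤ 1 := by exact_mod_cast h1
    rw [tsub_eq_zero_of_le h1'', zero_add, abs_of_nonpos (by linarith), neg_sub,
      ENNReal.ofReal_sub _ y.coe_nonneg]
    simp
  · have h1' : 1 ≤ (y : ℝ) := h1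
    have h1'' : 1 ≤ (y : ℝ≥0∞) := by exact_mod_cast h1
    rw [tsub_eq_zero_of_le h1'', add_zero, abs_of_nonneg (by linarith),
      ENNReal.ofReal_sub _ zero_le_one]
    simp

lemma young_ineq (h s : ℝ) (hh : 0 ≤ h) (hs : 0 ≤ s) :
    |h - 1| * s ≤ klFun h + Real.exp s - 1 - s := by
  have gen : ∀ r : ℝ, h * r ≤ h * Real.log h - h + Real.exp r := by
    intro r
    rcases hh.eq_or_lt with h0 | h0
    · simp [← h0]; positivity
    · have e : Real.exp r = h * Real.exp (r - Real.log h) := by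
        rw [Real.exp_sub, Real.exp_log h0]; field_simp
      have := Real.add_one_le_exp (r - Real.log h)
      rw [e]
      nlinarith [mul_le_mul_of_nonneg_left this hh]
  rw [klFun_apply]
  rcases le_total 1 h with h1 | h1
  · rw [abs_of_nonneg (by linarith)]
    linarith [gen s]
  · rw [abs_of_nonpos (by linarith)]
    have := gen (-s)
    have sh : s ≤ Real.sinh s := Real.self_le_sinh_iff.2 hs
    rw [Real.sinh_eq] at sh
    linarith

lemma exp_bound (t y : ℝ) (ht : 0 < t) (ht1 : t ≤ 1) (hy : 0 ≤ y) :
    Real.exp (t * y) - 1 - t * y ≤ 2 * t ^ 2 * Real.exp (2 * y) := by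
  set x := t * y with hx
  have hx0 : 0 ≤ x := by positivity
  have hxy : x ≤ y := by nlinarith
  have a1 : Real.exp x - 1 ≤ x * Real.exp x := by
    have := Real.add_one_le_exp (-x)
    have e : Real.exp (-x) * Real.exp x = 1 := by rw [← Real.exp_add]; simp
    nlinarith [Real.exp_pos x]
  have a2 : Real.exp x - 1 - x ≤ x ^ 2 * Real.exp x := by nlinarith
  have a3 := Real.quadratic_le_exp_of_nonneg hy
  have a4 : Real.exp x ≤ Real.exp y := Real.exp_le_exp.2 hxy
  have a5 : Real.exp (2 * y) = Real.exp y * Real.exp y := by rw [← Real.exp_add]; ring_nf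
  calc _ ≤ x ^ 2 * Real.exp x := a2
    _ ≤ x ^ 2 * Real.exp y := by gcongr
    _ = t ^ 2 * (y ^ 2 * Real.exp y) := by rw [hx]; ring
    _ ≤ t ^ 2 * ((2 * Real.exp y) * Real.exp y) := by gcongr; linarith
    _ = _ := by rw [a5]; ring

lemma tv_bound (q p : Measure ℝ) [IsProbabilityMeasure q] [IsProbabilityMeasure p]
    (hq : q ≪ p) (c t : ℝ) (hc : 0 < c) (ht : 0 < t) (ht1 : t ≤ 1) :
    ENNReal.ofReal c * ∫⁻ x, ENNReal.ofReal (x ^ 2 * |(q.rnDeriv p x).toReal - 1|) ∂p ≤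
      ENNReal.ofReal (1 / t) * klDiv q p +
        ENNReal.ofReal (2 * t) * ∫⁻ x, ENNReal.ofReal (Real.exp (2 * c * x ^ 2)) ∂p := by
  rw [klDiv_eq_lintegral_klFun_of_ac hq, ← lintegral_const_mul _ (by fun_prop),
    ← lintegral_const_mul _ (by fun_prop), ← lintegral_const_mul _ (by fun_prop),
    ← lintegral_add_left (by fun_prop)]
  refine lintegral_mono fun x => ?_
  set h := (q.rnDeriv p x).toReal
  have hh : 0 ≤ h := ENNReal.toReal_nonneg
  dsimp only
  rw [← ENNReal.ofReal_mul hc.le, ← ENNReal.ofReal_mul (by positivity),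
    ← ENNReal.ofReal_mul (by positivity),
    ← ENNReal.ofReal_add (mul_nonneg (by positivity) (klFun_nonneg hh)) (by positivity)]
  apply ENNReal.ofReal_le_ofReal
  have hy : 0 ≤ c * x ^ 2 := by positivity
  have b1 := young_ineq h (t * (c * x ^ 2)) hh (by positivity)
  have b2 := exp_bound t (c * x ^ 2) ht ht1 hy
  have e : 2 * c * x ^ 2 = 2 * (c * x ^ 2) := by ring
  rw [e]
  have : t * (c * (x ^ 2 * |h - 1|)) ≤
      t * (1 / t * klFun h + 2 * t * Real.exp (2 * (c * x ^ 2))) := by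
    have e2 : t * (1 / t * klFun h + 2 * t * Real.exp (2 * (c * x ^ 2))) =
      klFun h + 2 * t ^ 2 * Real.exp (2 * (c * x ^ 2)) := by field_simp
    rw [e2]
    nlinarith
  exact le_of_mul_le_mul_left this ht

lemma rnDeriv_le_of_le_volume (r : Measure ℝ) [IsProbabilityMeasure r] (m : ℝ) (v : ℝ≥0)
    (hv : v ≠ 0) (ε : ℝ) (hε : 0 < ε)
    (hr : ∀ s, MeasurableSet s → r s ≤ ENNReal.ofReal (1 / ε) * volume s) :
    r ≪ gaussianReal m v ∧ ∃ K0 K1 : ℝ, 0 ≤ K0 ∧ 0 ≤ K1 ∧ ∀ᵐ x ∂(gaussianReal m v),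
      (r.rnDeriv (gaussianReal m v) x).toReal ≤ Real.exp (K0 + K1 * x ^ 2) := by
  have hac : r ≪ volume := by
    refine Measure.AbsolutelyContinuous.mk fun s hs h0 => ?_
    have := hr s hs
    rw [h0, mul_zero] at this
    exact le_antisymm this (zero_le)
  have hac' : r ≪ gaussianReal m v := hac.trans (gaussianReal_absolutelyContinuous' m hv)
  have hv0 : (0 : ℝ) < v := by positivity
  refine ⟨hac', |Real.log (1 / ε * √(2 * Real.pi * v))| + m ^ 2 / v, 1 / v, by positivity,
    by positivity, ?_⟩
  have h1 : r.rnDeriv (gaussianReal m v) ≤ᵐ[gaussianReal m v]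
      fun x => ENNReal.ofReal (1 / ε) * (gaussianPDF m v x)⁻¹ := by
    refine ae_le_of_forall_setLIntegral_le_of_sigmaFinite (Measure.measurable_rnDeriv _ _)
      fun s hs _ => ?_
    rw [Measure.setLIntegral_rnDeriv hac']
    refine (hr s hs).trans (le_of_eq ?_)
    rw [lintegral_const_mul _ (by fun_prop), gaussianReal_of_var_ne_zero m hv,
      setLIntegral_withDensity_eq_setLIntegral_mul _ (by fun_prop) (by fun_prop) hs]
    congr 1
    rw [← setLIntegral_one]
    refine lintegral_congr fun x => ?_
    have hp := gaussianPDF_pos m hv x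
    rw [Pi.mul_apply, ENNReal.mul_inv_cancel hp.ne' (by simp [gaussianPDF])]
  filter_upwards [h1] with x hx
  have hp : 0 < gaussianPDFReal m v x := gaussianPDFReal_pos m v x hv
  have h2 : (r.rnDeriv (gaussianReal m v) x).toReal ≤ 1 / ε * (gaussianPDFReal m v x)⁻¹ := by
    refine ENNReal.toReal_le_of_le_ofReal (by positivity) (hx.trans (le_of_eq ?_))
    rw [gaussianPDF, ← ENNReal.ofReal_inv_of_pos hp, ENNReal.ofReal_mul (by positivity)]
  refine h2.trans ?_
  have hA : 0 < 1 / ε * √(2 * Real.pi * v) := by positivity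
  have h3 : 1 / ε * (gaussianPDFReal m v x)⁻¹ =
      Real.exp (Real.log (1 / ε * √(2 * Real.pi * v)) + (x - m) ^ 2 / (2 * v)) := by
    rw [Real.exp_add, Real.exp_log hA, gaussianPDFReal, mul_inv, inv_inv, ← Real.exp_neg, ← mul_assoc]
    congr 2
    ring
  rw [h3]
  refine Real.exp_le_exp.2 ?_
  have h4 := le_abs_self (Real.log (1 / ε * √(2 * Real.pi * v)))
  have h5 : (x - m) ^ 2 / (2 * v) ≤ m ^ 2 / v + 1 / v * x ^ 2 := by
    rw [div_add' _ _ _ hv0.ne', div_le_div_iff₀ (by positivity) hv0]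
    have : 1 / (v:ℝ) * x ^ 2 * v = x ^ 2 := by field_simp
    rw [this]
    nlinarith [sq_nonneg (x + m), mul_nonneg hv0.le (sq_nonneg (x+m))]
  linarith

lemma klDiv_lt_top_of_le (r p : Measure ℝ) [IsProbabilityMeasure r] [IsProbabilityMeasure p]
    (hac : r ≪ p) (K0 K1 : ℝ) (hK0 : 0 ≤ K0) (hK1 : 0 ≤ K1)
    (h : ∀ᵐ x ∂p, (r.rnDeriv p x).toReal ≤ Real.exp (K0 + K1 * x ^ 2)) (hr : sm r < ⊤) :
    klDiv r p < ⊤ := by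
  rw [klDiv_eq_lintegral_klFun_of_ac hac]
  have h1 : ∫⁻ x, ENNReal.ofReal (klFun (r.rnDeriv p x).toReal) ∂p ≤
      ∫⁻ x, (1 + r.rnDeriv p x * ENNReal.ofReal (K0 + K1 * x ^ 2)) ∂p := by
    refine lintegral_mono_ae ?_
    filter_upwards [h, Measure.rnDeriv_lt_top r p] with x hx hx2
    generalize r.rnDeriv p x = y at hx hx2
    lift y to ℝ≥0 using hx2.ne
    simp only [ENNReal.coe_toReal] at hx ⊢
    have : klFun (y : ℝ) ≤ 1 + y * (K0 + K1 * x ^ 2) := by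
      rw [klFun]
      rcases eq_or_lt_of_le y.coe_nonneg with h0 | h0
      · rw [← h0]; simp
      · have := (Real.log_le_iff_le_exp h0).2 hx
        nlinarith [mul_le_mul_of_nonneg_left this h0.le]
    refine (ENNReal.ofReal_le_ofReal this).trans ?_
    rw [ENNReal.ofReal_add zero_le_one (by positivity), ENNReal.ofReal_mul y.coe_nonneg]
    simp
  refine h1.trans_lt ?_
  rw [lintegral_add_left (by fun_prop), lintegral_rnDeriv_mul hac (by fun_prop)]
  have h2 : ∫⁻ x, ENNReal.ofReal (K0 + K1 * x ^ 2) ∂r =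
      ENNReal.ofReal K0 + ENNReal.ofReal K1 * sm r := by
    rw [sm, ← lintegral_const_mul _ (by fun_prop)]
    rw [show ENNReal.ofReal K0 = ∫⁻ x, ENNReal.ofReal K0 ∂r by simp,
      ← lintegral_add_left (by fun_prop)]
    refine lintegral_congr fun x => ?_
    rw [ENNReal.ofReal_add hK0 (by positivity), ENNReal.ofReal_mul hK1]
  rw [h2]
  simp only [lintegral_one, measure_univ]
  exact ENNReal.add_lt_top.2 ⟨ENNReal.one_lt_top, ENNReal.add_lt_top.2
    ⟨ENNReal.ofReal_lt_top, ENNReal.mul_lt_top ENNReal.ofReal_lt_top hr⟩⟩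

lemma smoothing (q : Measure ℝ) [IsProbabilityMeasure q] (m : ℝ) (v : ℝ≥0) (hv : v ≠ 0)
    (hq : sm q < ⊤) (ε : ℝ) (hε : 0 < ε) : ∃ cp : Measure (ℝ × ℝ), IsProbabilityMeasure cp ∧
      cp.fst = q ∧ KLD cp.snd (gaussianReal m v) < ⊤ ∧
      ∫⁻ z, ENNReal.ofReal ((z.1 - z.2) ^ 2) ∂cp ≤ ENNReal.ofReal (ε ^ 2) := by
  let ν : Measure ℝ := ENNReal.ofReal (1 / ε) • volume.restrict (Icc 0 ε)
  have hmul : ENNReal.ofReal (1 / ε) * ENNReal.ofReal ε = 1 := by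
    rw [← ENNReal.ofReal_mul (by positivity), one_div_mul_cancel hε.ne', ENNReal.ofReal_one]
  have hν : IsProbabilityMeasure ν := ⟨by simp [ν, -one_div, hmul]⟩
  let cp : Measure (ℝ × ℝ) := (q.prod ν).map (fun w => (w.1, w.1 + w.2))
  have hcp : IsProbabilityMeasure cp := Measure.isProbabilityMeasure_map (by fun_prop)
  have hfst : cp.fst = q := by
    rw [Measure.fst, Measure.map_map (by fun_prop) (by fun_prop)]
    exact Measure.fst_prod
  have hcost : ∫⁻ z, ENNReal.ofReal ((z.1 - z.2) ^ 2) ∂cp ≤ ENNReal.ofReal (ε ^ 2) := by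
    rw [lintegral_map (by fun_prop) (by fun_prop), lintegral_prod _ (by fun_prop)]
    have : ∀ x : ℝ, ∫⁻ y, ENNReal.ofReal ((x - (x + y)) ^ 2) ∂ν ≤ ENNReal.ofReal (ε ^ 2) := by
      intro x
      calc _ ≤ ∫⁻ y, ENNReal.ofReal (ε ^ 2) ∂ν := by
            refine lintegral_mono_ae ?_
            refine Measure.ae_smul_measure ?_ _
            filter_upwards [ae_restrict_mem measurableSet_Icc] with y hy
            refine ENNReal.ofReal_le_ofReal ?_
            have := hy.1
            have := hy.2
            nlinarith
        _ = _ := by simp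
    calc _ ≤ ∫⁻ x, ENNReal.ofReal (ε ^ 2) ∂q := lintegral_mono this
      _ = _ := by simp
  refine ⟨cp, hcp, hfst, ?_, hcost⟩
  have hr : ∀ s, MeasurableSet s → cp.snd s ≤ ENNReal.ofReal (1 / ε) * volume s := by
    intro s hs
    rw [Measure.snd_apply hs, Measure.map_apply (by fun_prop) (measurable_snd hs),
      Measure.prod_apply (by measurability)]
    have : ∀ x : ℝ, ν (Prod.mk x ⁻¹' ((fun w : ℝ × ℝ => (w.1, w.1 + w.2)) ⁻¹' (Prod.snd ⁻¹' s))) ≤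
        ENNReal.ofReal (1 / ε) * volume s := by
      intro x
      have e : (Prod.mk x ⁻¹' ((fun w : ℝ × ℝ => (w.1, w.1 + w.2)) ⁻¹' (Prod.snd ⁻¹' s))) =
        (fun y => x + y) ⁻¹' s := rfl
      rw [e, Measure.smul_apply, smul_eq_mul]
      have h6 : volume.restrict (Icc 0 ε) ((fun y => x + y) ⁻¹' s) ≤ volume s := by
        refine (Measure.restrict_apply_le _ _).trans ?_
        rw [measure_preimage_add]
      gcongr
    calc _ ≤ ∫⁻ x, ENNReal.ofReal (1 / ε) * volume s ∂q := lintegral_mono this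
      _ = _ := by simp
  have hsm : sm cp.snd < ⊤ := by
    refine (sm_le_cost cp).trans_lt ?_
    rw [hfst]
    exact ENNReal.add_lt_top.2 ⟨ENNReal.mul_lt_top (by simp) hq,
      ENNReal.mul_lt_top (by simp) (hcost.trans_lt ENNReal.ofReal_lt_top)⟩
  obtain ⟨hac, K0, K1, h0, h1, h⟩ := rnDeriv_le_of_le_volume cp.snd m v hv ε hε hr
  rw [KLD_eq_klDiv]
  exact klDiv_lt_top_of_le _ _ hac K0 K1 h0 h1 h hsm

lemma DRP_zero_lt_top (p : Measure ℝ) [IsProbabilityMeasure p] (hp : sm p < ⊤) (R Rc : ℝ≥0∞) :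
    DRP p (fun p q => KLD q p) R Rc 0 < ⊤ := by
  let μ : Measure (ℝ × ℝ × ℝ) := p.prod ((Measure.dirac 0).prod p)
  have h1 : μ.map (fun w => w.1) = p := Measure.fst_prod
  have h2' : μ.map (fun w => w.2) = (Measure.dirac 0).prod p := Measure.snd_prod
  have h2 : μ.map (fun w => w.2.1) = Measure.dirac 0 := by
    have e := Measure.map_map (μ := μ) (g := Prod.fst) (f := fun w : ℝ × ℝ × ℝ => w.2)
      (by fun_prop) (by fun_prop)
    refine e.symm.trans ?_
    rw [h2']
    exact Measure.fst_prod
  have h3 : μ.map (fun w => w.2.2) = p := by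
    have e := Measure.map_map (μ := μ) (g := Prod.snd) (f := fun w : ℝ × ℝ × ℝ => w.2)
      (by fun_prop) (by fun_prop)
    refine e.symm.trans ?_
    rw [h2']
    exact Measure.snd_prod
  have h4 : μ.map (fun w => (w.1, w.2.1)) = p.prod (Measure.dirac 0) := by
    have := Measure.map_prod_map p ((Measure.dirac (0:ℝ)).prod p) (f := id) (g := Prod.fst)
      measurable_id measurable_fst
    rw [Measure.map_id, show ((Measure.dirac (0:ℝ)).prod p).map Prod.fst = Measure.dirac 0 from
      Measure.fst_prod] at this
    exact this.symm
  have h5 : μ.map (fun w => (w.2.2, w.2.1)) = p.prod (Measure.dirac 0) := by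
    have e := Measure.map_map (μ := μ) (g := Prod.swap) (f := fun w : ℝ × ℝ × ℝ => w.2)
      (by fun_prop) (by fun_prop)
    refine e.symm.trans ?_
    rw [h2', Measure.prod_swap]
  have hfe : DRPfeasible p (fun p q => KLD q p) R Rc 0 μ := by
    refine ⟨inferInstance, h1, ?_, ?_, ?_, ?_⟩
    · refine condIndep_of_kernels μ (Kernel.const _ p) (Kernel.const _ p) ?_
      intro s t u hs ht hu
      rw [h2]
      simp only [μ, Measure.prod_prod, Kernel.const_apply, lintegral_const,
        Measure.restrict_apply_univ]
      ring
    · rw [mutInfo, h4, h1, h2, KLD_eq_klDiv, klDiv_self]; exact zero_le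
    · rw [mutInfo, h5, h3, h2, KLD_eq_klDiv, klDiv_self]; exact zero_le
    · simp only
      rw [h3, KLD_eq_klDiv, klDiv_self]
  refine (iInf₂_le μ hfe).trans_lt ?_
  have := cost_le_sm (μ.map (fun w => (w.1, w.2.2)))
  rw [Measure.fst, Measure.snd, Measure.map_map (by fun_prop) (by fun_prop),
    Measure.map_map (by fun_prop) (by fun_prop), lintegral_map (by fun_prop) (by fun_prop)] at this
  refine this.trans_lt ?_
  change 2 * sm (μ.map (fun w => w.1)) + 2 * sm (μ.map (fun w => w.2.2)) < ⊤
  rw [h1, h3]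
  have := ENNReal.mul_lt_top (a := 2) (by simp) hp
  exact ENNReal.add_lt_top.2 ⟨this, this⟩

lemma DRP_antitone (p : Measure ℝ) (R Rc : ℝ≥0∞) :
    Antitone (DRP p (fun p q => KLD q p) R Rc) := by
  intro P P' h
  refine le_iInf₂ fun μ hμ => iInf₂_le μ ?_
  obtain ⟨a, b, c, d, e, f⟩ := hμ
  exact ⟨a, b, c, d, e, f.trans h⟩

lemma continuous_of_antitone_approx (f : ℝ≥0∞ → ℝ≥0∞) (hf : Antitone f)
    (hfin : f 0 < ⊤)
    (hL : ∀ P, 0 < P → ∀ ε : ℝ≥0∞, 0 < ε → ∃ P1 < P, f P1 ≤ f P + ε)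
    (hR : ∀ P, P < ⊤ → ∀ ε : ℝ≥0∞, 0 < ε → ∃ P1 > P, f P ≤ f P1 + ε) : Continuous f := by
  have hlt : ∀ P, f P < ⊤ := fun P => (hf zero_le).trans_lt hfin
  refine continuous_iff_continuousAt.2 fun P => tendsto_order.2 ⟨fun a ha => ?_, fun a ha => ?_⟩
  · rcases eq_or_lt_of_le (le_top : P ≤ ⊤) with rfl | hP
    · exact Filter.Eventually.of_forall fun x => ha.trans_le (hf le_top)
    · obtain ⟨b, hb1, hb2⟩ := exists_between ha
      obtain ⟨P1, h1, h2⟩ := hR P hP (f P - b) (tsub_pos_of_lt hb2)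
      have h3 : b ≤ f P1 := by
        by_contra! hc
        have : f P1 + (f P - b) < b + (f P - b) :=
          ENNReal.add_lt_add_right ((tsub_le_self.trans_lt (hlt P)).ne) hc
        rw [add_tsub_cancel_of_le hb2.le] at this
        exact absurd (h2.trans_lt this) (lt_irrefl _)
      filter_upwards [Iio_mem_nhds h1] with x hx
      exact hb1.trans_le (h3.trans (hf (le_of_lt hx)))
  · rcases eq_or_lt_of_le (zero_le : 0 ≤ P) with rfl | hP
    · exact Filter.Eventually.of_forall fun x => (hf zero_le).trans_lt ha
    · obtain ⟨b, hb1, hb2⟩ := exists_between ha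
      obtain ⟨P1, h1, h2⟩ := hL P hP (b - f P) (tsub_pos_of_lt hb1)
      rw [add_tsub_cancel_of_le hb1.le] at h2
      filter_upwards [Ioi_mem_nhds h1] with x hx
      exact ((hf (le_of_lt hx)).trans h2).trans_lt hb2

lemma choose_params (M : ℝ≥0∞) (hM : M < ⊤) (ε : ℝ≥0∞) (hε : 0 < ε) :
    ∃ η : ℝ, 0 < η ∧ ∃ δ : ℝ, 0 < δ ∧ ∀ F ≤ M, ∀ C ≤ ENNReal.ofReal δ,
      ENNReal.ofReal (1 + η) * F + ENNReal.ofReal (1 + 1 / η) * C ≤ F + ε := by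
  wlog hε' : ε < ⊤ generalizing ε
  · obtain ⟨η, h1, δ, h2, -⟩ := this 1 one_pos ENNReal.one_lt_top
    have : ε = ⊤ := by simpa using hε'
    exact ⟨η, h1, δ, h2, fun F _ C _ => by simp [this]⟩
  lift M to ℝ≥0 using hM.ne
  lift ε to ℝ≥0 using hε'.ne
  have he : (0 : ℝ) < ε := by exact_mod_cast hε
  have hm : (0 : ℝ) < 2 * (M + 1) := by positivity
  have hη : 0 < (ε : ℝ) / (2 * (M + 1)) := by positivity
  set η := (ε : ℝ) / (2 * (M + 1)) with hηdef
  refine ⟨η, hη, ε / (2 * (1 + 1 / η)), by positivity, fun F hF C hC => ?_⟩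
  lift F to ℝ≥0 using (hF.trans_lt hM).ne
  lift C to ℝ≥0 using (hC.trans_lt ENNReal.ofReal_lt_top).ne
  have hF' : (F : ℝ) ≤ M := by exact_mod_cast hF
  have hC' : (C : ℝ) ≤ ε / (2 * (1 + 1 / η)) := by
    have := ENNReal.toReal_mono ENNReal.ofReal_ne_top hC
    rwa [ENNReal.toReal_ofReal (by positivity)] at this
  rw [← ENNReal.ofReal_coe_nnreal (p := F), ← ENNReal.ofReal_coe_nnreal (p := C),
    ← ENNReal.ofReal_coe_nnreal (p := ε), ← ENNReal.ofReal_mul (by positivity),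
    ← ENNReal.ofReal_mul (by positivity), ← ENNReal.ofReal_add (by positivity) (by positivity),
    ← ENNReal.ofReal_add (by positivity) (by positivity)]
  refine ENNReal.ofReal_le_ofReal ?_
  have h1 : η * F ≤ ε / 2 := by
    calc η * F ≤ η * (M + 1) := by gcongr; linarith
      _ = ε / 2 := by rw [hηdef]; field_simp
  have h2 : (1 + 1 / η) * C ≤ ε / 2 := by
    calc (1 + 1 / η) * C ≤ (1 + 1 / η) * (ε / (2 * (1 + 1 / η))) := by gcongr
      _ = ε / 2 := by field_simp
  linarith

lemma approx (p : Measure ℝ) (R Rc M ε : ℝ≥0∞) (hM : M < ⊤) (hε : 0 < ε) :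
    ∃ δ : ℝ, 0 < δ ∧ ∀ P P' : ℝ≥0∞, DRP p (fun p q => KLD q p) R Rc P < M →
      (∀ q : Measure ℝ, IsProbabilityMeasure q → sm q ≤ 2 * sm p + 2 * M → KLD q p ≤ P →
        ∃ cp : Measure (ℝ × ℝ), IsProbabilityMeasure cp ∧ cp.fst = q ∧ KLD cp.snd p ≤ P' ∧
          ∫⁻ z, ENNReal.ofReal ((z.1 - z.2) ^ 2) ∂cp ≤ ENNReal.ofReal δ) →
      DRP p (fun p q => KLD q p) R Rc P' ≤ DRP p (fun p q => KLD q p) R Rc P + ε := by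
  obtain ⟨η, hη, δ, hδ, h⟩ := choose_params M hM ε hε
  refine ⟨δ, hδ, fun P P' hP H => ?_⟩
  by_contra! hc
  have h1 : DRP p (fun p q => KLD q p) R Rc P <
      min M (DRP p (fun p q => KLD q p) R Rc P' - ε) :=
    lt_min hP (lt_tsub_iff_right.2 hc)
  rw [DRP] at h1
  simp only [iInf_lt_iff] at h1
  obtain ⟨μ, hμ, hlt⟩ := h1
  have hμ' := hμ
  obtain ⟨hprob, hX, -, -, -, hK⟩ := hμ'
  have hd := hlt.trans_le (min_le_left _ _)
  have hd2 := lt_tsub_iff_right.1 (hlt.trans_le (min_le_right _ _))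
  have hs := sm_out_le μ
  rw [hX] at hs
  obtain ⟨cp, hcp, e1, e2, e3⟩ := H (μ.map (fun w => w.2.2))
    (Measure.isProbabilityMeasure_map (by fun_prop)) (hs.trans (by gcongr)) hK
  have := perturb hμ cp e1 e2 η hη
  exact absurd ((this.trans (h _ hd.le _ e3)).trans_lt hd2) (lt_irrefl _)

lemma approx_top (p : Measure ℝ) (R Rc M ε : ℝ≥0∞) (hM : M < ⊤) (hε : 0 < ε)
    (hp : sm p < ⊤) (hfM : DRP p (fun p q => KLD q p) R Rc ⊤ < M)
    (H : ∀ q : Measure ℝ, IsProbabilityMeasure q → sm q < ⊤ → ∀ δ : ℝ, 0 < δ →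
        ∃ cp : Measure (ℝ × ℝ), IsProbabilityMeasure cp ∧ cp.fst = q ∧ KLD cp.snd p < ⊤ ∧
          ∫⁻ z, ENNReal.ofReal ((z.1 - z.2) ^ 2) ∂cp ≤ ENNReal.ofReal (δ ^ 2)) :
    ∃ P1 < ⊤, DRP p (fun p q => KLD q p) R Rc P1 ≤
      DRP p (fun p q => KLD q p) R Rc ⊤ + ε := by
  have hε2 : 0 < ε / 2 := ENNReal.half_pos hε.ne'
  obtain ⟨η, hη, δ, hδ, h⟩ := choose_params M hM (ε / 2) hε2
  have h1 : DRP p (fun p q => KLD q p) R Rc ⊤ <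
      min M (DRP p (fun p q => KLD q p) R Rc ⊤ + ε / 2) :=
    lt_min hfM (ENNReal.lt_add_right (hfM.trans hM).ne hε2.ne')
  nth_rewrite 1 [DRP] at h1
  simp only [iInf_lt_iff] at h1
  obtain ⟨μ, hμ, hlt⟩ := h1
  have hμ' := hμ
  obtain ⟨hprob, hX, -, -, -, hK⟩ := hμ'
  have hd := hlt.trans_le (min_le_left _ _)
  have hd2 := hlt.trans_le (min_le_right _ _)
  have hs := sm_out_le μ
  rw [hX] at hs
  obtain ⟨cp, hcp, e1, e2, e3⟩ := H (μ.map (fun w => w.2.2))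
    (Measure.isProbabilityMeasure_map (by fun_prop)) (hs.trans_lt (ENNReal.add_lt_top.2
      ⟨ENNReal.mul_lt_top (by simp) hp, ENNReal.mul_lt_top (by simp) (hd.trans hM)⟩))
    (√δ) (Real.sqrt_pos.2 hδ)
  rw [Real.sq_sqrt hδ.le] at e3
  refine ⟨_, e2, (perturb hμ cp e1 le_rfl η hη).trans ((h _ hd.le _ e3).trans ?_)⟩
  calc distortion μ + ε / 2 ≤ (DRP p (fun p q => KLD q p) R Rc ⊤ + ε / 2) + ε / 2 := by gcongr
    _ = _ := by rw [add_assoc, ENNReal.add_halves]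

lemma exists_weight (S : ℝ≥0∞) (hS : S < ⊤) (δ : ℝ) (hδ : 0 < δ) :
    ∃ a b : ℝ≥0, a + b = 1 ∧ 0 < a ∧ a < 1 ∧ b * S ≤ ENNReal.ofReal δ := by
  lift S to ℝ≥0 using hS.ne
  lift δ to ℝ≥0 using hδ.le
  have hδ' : 0 < δ := by exact_mod_cast hδ
  have hb : min (1 / 2) (δ / (S + 1)) ≤ (1 : ℝ≥0) / 2 := min_le_left _ _
  have hb0 : 0 < min (1 / 2) (δ / (S + 1)) := lt_min (by positivity) (by positivity)
  have hb2 : min (1 / 2) (δ / (S + 1)) ≤ δ / (S + 1) := min_le_right _ _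
  generalize min (1 / 2) (δ / (S + 1)) = b at hb hb0 hb2
  have hb1 : b < 1 := hb.trans_lt (by rw [← NNReal.coe_lt_coe]; norm_num)
  refine ⟨1 - b, b, tsub_add_cancel_of_le hb1.le, tsub_pos_of_lt hb1,
    tsub_lt_self one_pos hb0, ?_⟩
  rw [ENNReal.ofReal_coe_nnreal]
  norm_cast
  calc b * S ≤ δ / (S + 1) * (S + 1) := by gcongr; simp
    _ = δ := by rw [div_mul_cancel₀]; positivity

lemma tv_total (p : Measure ℝ) [IsProbabilityMeasure p] (c : ℝ) (hc : 0 < c)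
    (hE : ∫⁻ x, ENNReal.ofReal (Real.exp (2 * c * x ^ 2)) ∂p < ⊤) (δ : ℝ) (hδ : 0 < δ) :
    ∃ P1 : ℝ≥0∞, 0 < P1 ∧ ∀ q : Measure ℝ, IsProbabilityMeasure q → KLD q p ≤ P1 →
      ∃ cp : Measure (ℝ × ℝ), IsProbabilityMeasure cp ∧ cp.fst = q ∧ cp.snd = p ∧
          ∫⁻ z, ENNReal.ofReal ((z.1 - z.2) ^ 2) ∂cp ≤ ENNReal.ofReal δ := by
  generalize hEE : ∫⁻ x, ENNReal.ofReal (Real.exp (2 * c * x ^ 2)) ∂p = E at hE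
  lift E to ℝ≥0 using hE.ne
  have ht0 : 0 < min 1 (δ * c / (2 * (1 + 2 * (E : ℝ)))) := lt_min one_pos (by positivity)
  have ht1 : min 1 (δ * c / (2 * (1 + 2 * (E : ℝ)))) ≤ 1 := min_le_left _ _
  have ht2 : min 1 (δ * c / (2 * (1 + 2 * (E : ℝ)))) ≤ δ * c / (2 * (1 + 2 * (E : ℝ))) :=
    min_le_right _ _
  generalize min 1 (δ * c / (2 * (1 + 2 * (E : ℝ)))) = t at ht0 ht1 ht2
  refine ⟨ENNReal.ofReal (t ^ 2), by simpa using pow_pos ht0 2, fun q hq hK => ?_⟩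
  rw [KLD_eq_klDiv] at hK
  have hac : q ≪ p := (klDiv_ne_top_iff.1 (hK.trans_lt ENNReal.ofReal_lt_top).ne).1
  obtain ⟨cp, h1, h2, h3, h4⟩ := tv_coupling q p hac
  refine ⟨cp, h1, h2, h3, h4.trans ?_⟩
  have hb := tv_bound q p hac c t hc ht0 ht1
  rw [hEE] at hb
  generalize ∫⁻ x, ENNReal.ofReal (x ^ 2 * |(q.rnDeriv p x).toReal - 1|) ∂p = I at hb
  have hb2 : ENNReal.ofReal c * I ≤ ENNReal.ofReal (t * (1 + 2 * E)) := by
    calc _ ≤ _ := hb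
      _ ≤ ENNReal.ofReal (1 / t) * ENNReal.ofReal (t ^ 2) + ENNReal.ofReal (2 * t) * E := by gcongr
      _ = _ := by
        rw [← ENNReal.ofReal_coe_nnreal (p := E), ← ENNReal.ofReal_mul (by positivity),
          ← ENNReal.ofReal_mul (by positivity), ← ENNReal.ofReal_add (by positivity)
          (by positivity)]
        congr 1
        field_simp
  have hci : ENNReal.ofReal (2 / c) * ENNReal.ofReal c = 2 := by
    rw [← ENNReal.ofReal_mul (by positivity), div_mul_cancel₀ _ hc.ne']
    simp
  calc 2 * I = ENNReal.ofReal (2 / c) * (ENNReal.ofReal c * I) := by rw [← mul_assoc, hci]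
    _ ≤ ENNReal.ofReal (2 / c) * ENNReal.ofReal (t * (1 + 2 * E)) := by gcongr
    _ = ENNReal.ofReal (2 / c * (t * (1 + 2 * E))) := by rw [← ENNReal.ofReal_mul (by positivity)]
    _ ≤ ENNReal.ofReal δ := by
      refine ENNReal.ofReal_le_ofReal ?_
      calc 2 / c * (t * (1 + 2 * E)) ≤
            2 / c * (δ * c / (2 * (1 + 2 * (E : ℝ))) * (1 + 2 * E)) := by gcongr
        _ = δ := by field_simp

lemma main_cont (m : ℝ) (v : ℝ≥0) (hv : v ≠ 0) (R Rc : ℝ≥0∞) :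
    Continuous (DRP (gaussianReal m v) (fun p q => KLD q p) R Rc) := by
  have hsm : sm (gaussianReal m v) < ⊤ := by
    have h := (IsGaussian.memLp_two_id (μ := gaussianReal m v)).integrable_sq
    have := h.lintegral_lt_top
    simpa [sm] using this
  have hexp : ∃ c : ℝ, 0 < c ∧
      ∫⁻ x, ENNReal.ofReal (Real.exp (2 * c * x ^ 2)) ∂(gaussianReal m v) < ⊤ := by
    obtain ⟨C, hC, h⟩ := IsGaussian.exists_integrable_exp_sq (gaussianReal m v)
    refine ⟨C / 2, by positivity, ?_⟩
    have := h.lintegral_lt_top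
    have e : 2 * (C / 2) = C := by ring
    simpa [e] using this
  have klself : KLD (gaussianReal m v) (gaussianReal m v) = 0 := by
    rw [KLD_eq_klDiv, klDiv_self]
  have hfin := DRP_zero_lt_top (gaussianReal m v) hsm R Rc
  have hanti := DRP_antitone (gaussianReal m v) R Rc
  have hsf := fun (q : Measure ℝ) (hq : IsProbabilityMeasure q) => smoothing q m v hv
  have hpr : IsProbabilityMeasure (gaussianReal m v) := inferInstance
  generalize gaussianReal m v = p at *
  set f := DRP p (fun p q => KLD q p) R Rc with hf
  have hM : f 0 + 1 < ⊤ := ENNReal.add_lt_top.2 ⟨hfin, ENNReal.one_lt_top⟩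
  have hfM : ∀ P, f P < f 0 + 1 := fun P =>
    (hanti zero_le).trans_lt (ENNReal.lt_add_right hfin.ne one_ne_zero)
  have hS : 2 * (2 * sm p + 2 * (f 0 + 1)) + 2 * sm p < ⊤ := by
    have h2 : (2 : ℝ≥0∞) < ⊤ := by simp
    exact ENNReal.add_lt_top.2 ⟨ENNReal.mul_lt_top h2 (ENNReal.add_lt_top.2
      ⟨ENNReal.mul_lt_top h2 hsm, ENNReal.mul_lt_top h2 hM⟩), ENNReal.mul_lt_top h2 hsm⟩
  have key : ∀ ε : ℝ≥0∞, 0 < ε → ∃ a : ℝ≥0, 0 < a ∧ a < 1 ∧ ∀ P, f (a * P) ≤ f P + ε := by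
    intro ε hε
    obtain ⟨δ, hδ, h⟩ := approx p R Rc _ ε hM hε
    obtain ⟨a, b, hab, ha0, ha1, hb⟩ := exists_weight _ hS δ hδ
    refine ⟨a, ha0, ha1, fun P => h P _ (hfM P) fun q hq hq2 hK => ?_⟩
    obtain ⟨cp, h1, h2, h3, h4⟩ := mix_coupling q p a b hab
    refine ⟨cp, h1, h2, h3.trans (by gcongr), h4.trans (le_trans ?_ hb)⟩
    gcongr
  refine continuous_of_antitone_approx f hanti hfin ?_ ?_
  · intro P hP ε hε
    rcases eq_or_lt_of_le (le_top : P ≤ ⊤) with rfl | hPt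
    · exact approx_top p R Rc _ ε hM hε hsm (hfM ⊤) (fun q hq h δ hδ => hsf q hq h δ hδ)
    · obtain ⟨a, ha0, ha1, h⟩ := key ε hε
      refine ⟨a * P, ?_, h P⟩
      have : (a : ℝ≥0∞) * P < 1 * P :=
        ENNReal.mul_lt_mul_left hP.ne' hPt.ne (by exact_mod_cast ha1)
      rwa [one_mul] at this
  · intro P hPt ε hε
    rcases eq_or_lt_of_le (zero_le : 0 ≤ P) with rfl | hP
    · obtain ⟨δ, hδ, h⟩ := approx p R Rc _ ε hM hε
      obtain ⟨c, hc, hE⟩ := hexp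
      obtain ⟨P1, hP1, H⟩ := tv_total p c hc hE δ hδ
      refine ⟨P1, hP1, h P1 0 (hfM P1) fun q hq _ hK => ?_⟩
      obtain ⟨cp, h1, h2, h3, h4⟩ := H q hq hK
      exact ⟨cp, h1, h2, by rw [h3, klself], h4⟩
    · obtain ⟨a, ha0, ha1, h⟩ := key ε hε
      have ha : (a : ℝ≥0∞) ≠ 0 := by exact_mod_cast ha0.ne'
      have e : (a : ℝ≥0∞) * (P / a) = P := ENNReal.mul_div_cancel ha ENNReal.coe_ne_top
      refine ⟨P / a, ?_, ?_⟩
      · have h0 : P / a ≠ 0 := fun h0 => by rw [h0, mul_zero] at e; exact hP.ne e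
        have ht : P / a ≠ ⊤ := (ENNReal.div_lt_top hPt.ne ha).ne
        have : (a : ℝ≥0∞) * (P / a) < 1 * (P / a) :=
          ENNReal.mul_lt_mul_left h0 ht (by exact_mod_cast ha1)
        rwa [one_mul, e] at this
      · have := h (P / a)
        rwa [e] at this

/-- Continuity of `P ↦ D(R, R_c, P | φ_KL)` on `[0,∞]` for Gaussian sources. -/
theorem stmt13 (μX σX : ℝ) (hσX : 0 < σX) (R Rc : ℝ≥0∞) :
    Continuous (fun P : ℝ≥0∞ => DRP (gauss μX σX) (fun p q => KLD q p) R Rc P) := by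
  have hv : (⟨σX ^ 2, sq_nonneg σX⟩ : ℝ≥0) ≠ 0 := by
    intro h
    have h' := congrArg NNReal.toReal h
    exact (pow_pos hσX 2).ne' h'
  exact main_cont μX ⟨σX ^ 2, sq_nonneg σX⟩ hv R Rc
end

section
/- Let p_X be the Gaussian distribution N(μ_X, σ_X²) with σ_X > 0, and let R ∈ (0,∞) and R_c ∈ [0,∞). Then the distortion-rate-perception function without perception constraint satisfies the strict inequality D(R,R_c,∞) > σ_X² e^{−2R}. -/
open MeasureTheory ProbabilityTheory Real Set
open scoped ENNReal NNReal

open InformationTheory in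
lemma aux_dv {Ω α β : Type*} [MeasurableSpace Ω] [MeasurableSpace α] [MeasurableSpace β]
    (μ : Measure Ω) [IsProbabilityMeasure μ] (f : Ω → α) (g : Ω → β) (hf : Measurable f)
    (hg : Measurable g) (C : ℝ≥0∞) (hC : C ≠ ⊤) (h : mutInfo μ f g ≤ C)
    (F : α × β → ℝ) (hF : Measurable F) (hi : Integrable (fun ω => F (f ω, g ω)) μ)
    (he : Integrable (fun z => Real.exp (F z)) ((μ.map f).prod (μ.map g))) :
    ∫ ω, F (f ω, g ω) ∂μ - (∫ z, Real.exp (F z) ∂((μ.map f).prod (μ.map g)) - 1) ≤ C.toReal := by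
  unfold mutInfo KLD at h
  set q := μ.map (fun ω => (f ω, g ω)) with hq
  set p := (μ.map f).prod (μ.map g) with hp
  have hfg : Measurable (fun ω => (f ω, g ω)) := hf.prodMk hg
  have : IsProbabilityMeasure q := Measure.isProbabilityMeasure_map hfg.aemeasurable
  have : IsProbabilityMeasure (μ.map f) := Measure.isProbabilityMeasure_map hf.aemeasurable
  have : IsProbabilityMeasure (μ.map g) := Measure.isProbabilityMeasure_map hg.aemeasurable
  split_ifs at h with hh
  swap
  · exact absurd (top_le_iff.mp h) hC
  obtain ⟨hac, hint⟩ := hh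
  have h1 : ∫ x, llr q p x ∂q ≤ C.toReal := (ENNReal.ofReal_le_iff_le_toReal hC).mp h
  have hiq : Integrable F q := (integrable_map_measure hF.aestronglyMeasurable hfg.aemeasurable).mpr hi
  have hFq : ∫ z, F z ∂q = ∫ ω, F (f ω, g ω) ∂μ := 
    integral_map hfg.aemeasurable hF.aestronglyMeasurable
  have h2 := integral_llr_tilted_right hac hiq he hint
  have hac2 : q ≪ p.tilted F := hac.trans (absolutelyContinuous_tilted he)
  have : IsProbabilityMeasure (p.tilted F) := isProbabilityMeasure_tilted he
  have h3 := integral_llr_add_sub_measure_univ_nonneg hac2 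
    (integrable_llr_tilted_right hac hiq hint he)
  simp only [probReal_univ] at h3
  have hpos : 0 < ∫ z, Real.exp (F z) ∂p := integral_exp_pos he
  have h4 := Real.log_le_sub_one_of_pos hpos
  rw [hFq] at h2
  linarith

lemma aux_cos_gauss (m : ℝ) (v : ℝ≥0) (s c : ℝ) :
    ∫ x, Real.cos (s * x + c) ∂(gaussianReal m v) = 
      Real.cos (s * m + c) * Real.exp (-(v * s ^ 2 / 2)) := by
  have h := charFun_gaussianReal (μ := m) (v := v) s
  rw [charFun_apply_real] at h
  have hi : Integrable (fun x : ℝ => Complex.exp (s * x * Complex.I)) (gaussianReal m v) := by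
    refine Integrable.of_bound (by fun_prop) 1 (ae_of_all _ fun x => ?_)
    have : (s * x * Complex.I : ℂ) = ((s * x : ℝ) : ℂ) * Complex.I := by push_cast; ring
    rw [this, Complex.norm_exp_ofReal_mul_I]
  have h2 : ∫ x, Complex.exp (c * Complex.I) * Complex.exp (s * x * Complex.I) ∂(gaussianReal m v)
      = Complex.exp (c * Complex.I) * Complex.exp (s * m * Complex.I - v * s ^ 2 / 2) := by
    rw [integral_const_mul, h]
  have h3 := congrArg Complex.re h2
  have h4 := integral_re (hi.const_mul (Complex.exp (c * Complex.I)))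
  simp only [RCLike.re_eq_complex_re] at h4
  rw [← h4] at h3
  have e1 : ∀ x : ℝ, (Complex.exp (c * Complex.I) * Complex.exp (s * x * Complex.I)).re =
      Real.cos (s * x + c) := by
    intro x
    rw [← Complex.exp_add]
    have : (c * Complex.I + s * x * Complex.I : ℂ) = ((s * x + c : ℝ) : ℂ) * Complex.I := by
      push_cast; ring
    rw [this, Complex.exp_ofReal_mul_I_re]
  have e2 : (Complex.exp (c * Complex.I) * Complex.exp (s * m * Complex.I - v * s ^ 2 / 2)).re =
      Real.cos (s * m + c) * Real.exp (-(v * s ^ 2 / 2)) := by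
    rw [← Complex.exp_add]
    have : (c * Complex.I + (s * m * Complex.I - v * s ^ 2 / 2) : ℂ) = 
      ((-(v * s ^ 2 / 2) : ℝ) : ℂ) + ((s * m + c : ℝ) : ℂ) * Complex.I := by
      push_cast; ring
    rw [this, Complex.exp_add, ← Complex.ofReal_exp, Complex.re_ofReal_mul, 
      Complex.exp_ofReal_mul_I_re, mul_comm]
  simp only [e1, e2] at h3
  exact h3

lemma aux_choose (κ D η : ℝ) (hκ : 0 < κ) (hη : 0 < η) : ∃ ρ : ℝ, 0 < ρ ∧ ∃ τ : ℝ, 0 < τ ∧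
    ∫ z, min 1 (Real.exp (-(κ * (ρ * z) ^ 2 / 2)) + τ * Real.exp (D * (ρ * z) ^ 2 / 2)) 
      ∂(gaussianReal 0 1) ≤ η := by
  have key : Filter.Tendsto (fun n : ℕ => ∫ z, min 1 (Real.exp (-(κ * ((n : ℝ) * z) ^ 2 / 2)) +
      Real.exp (-(n : ℝ) ^ 3) * Real.exp (D * ((n : ℝ) * z) ^ 2 / 2)) ∂(gaussianReal 0 1)) 
      Filter.atTop (nhds (∫ z : ℝ, (0 : ℝ) ∂(gaussianReal 0 1))) := by
    refine tendsto_integral_of_dominated_convergence (fun _ => 1) ?_ (integrable_const _) ?_ ?_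
    · intro n; fun_prop
    · intro n
      refine ae_of_all _ fun z => ?_
      rw [Real.norm_of_nonneg (by positivity)]
      exact min_le_left _ _
    · have hz : ∀ᵐ z : ℝ ∂(gaussianReal 0 1), z ≠ 0 := by
        have := nullSingletonClass_gaussianReal (μ := 0) (v := 1) one_ne_zero
        exact Measure.ae_ne _ _
      filter_upwards [hz] with z hz
      have hN : Filter.Tendsto (fun n : ℕ => (n : ℝ)) Filter.atTop Filter.atTop := 
        tendsto_natCast_atTop_atTop
      have t1 : Filter.Tendsto (fun n : ℕ => Real.exp (-(κ * ((n : ℝ) * z) ^ 2 / 2))) 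
          Filter.atTop (nhds 0) := by
        apply Real.tendsto_exp_neg_atTop_nhds_zero.comp
        have : Filter.Tendsto (fun n : ℕ => (κ * z ^ 2 / 2) * (n : ℝ) ^ 2) Filter.atTop Filter.atTop := by
          apply Filter.Tendsto.const_mul_atTop (by positivity)
          exact (Filter.tendsto_pow_atTop (by norm_num)).comp hN
        refine this.congr fun n => by ring
      have t2 : Filter.Tendsto (fun n : ℕ => Real.exp (-(n : ℝ) ^ 3) * 
          Real.exp (D * ((n : ℝ) * z) ^ 2 / 2)) Filter.atTop (nhds 0) := by
        have : Filter.Tendsto (fun n : ℕ => (n : ℝ) ^ 2 * ((n : ℝ) - D * z ^ 2 / 2)) 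
            Filter.atTop Filter.atTop := by
          apply Filter.Tendsto.atTop_mul_atTop₀
          · exact (Filter.tendsto_pow_atTop (by norm_num)).comp hN
          · exact Filter.tendsto_atTop_add_const_right _ _ hN
        refine (Real.tendsto_exp_neg_atTop_nhds_zero.comp this).congr fun n => ?_
        simp only [Function.comp]
        rw [← Real.exp_add]; congr 1; ring
      have t3 := (tendsto_const_nhds (x := (1 : ℝ))).min (t1.add t2)
      simpa using t3
  rw [integral_zero] at key
  have ev := (key.eventually (eventually_le_nhds hη)).and (Filter.eventually_gt_atTop 0)
  obtain ⟨n, h1, h2⟩ := ev.exists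
  exact ⟨n, by exact_mod_cast h2, Real.exp (-(n : ℝ) ^ 3), Real.exp_pos _, h1⟩

lemma aux_pdf (m v : ℝ) (S D : ℝ≥0) (hS : S ≠ 0) (r : ℝ)
    (hDS : (D : ℝ) = S * Real.exp (-2 * r)) (x : ℝ) :
    gaussianPDFReal m S x * Real.exp (r + (x - m) ^ 2 / (2 * S) - (x - v) ^ 2 / (2 * D)) =
      gaussianPDFReal v D x := by
  have hS' : (0 : ℝ) < S := by positivity
  have h1 : √(2 * π * D) = √(2 * π * S) * Real.exp (-r) := by
    rw [hDS, ← mul_assoc, Real.sqrt_mul (by positivity)]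
    congr 1
    rw [show -2 * r = -r + -r by ring, Real.exp_add, Real.sqrt_mul_self (Real.exp_pos _).le]
  unfold gaussianPDFReal
  rw [h1, mul_inv, ← Real.exp_neg, neg_neg, mul_assoc _ (Real.exp _) (Real.exp _), 
    mul_assoc _ (Real.exp _) (Real.exp _), ← Real.exp_add, ← Real.exp_add]
  congr 2
  ring

lemma aux_tilt (m v : ℝ) (S D : ℝ≥0) (hS : S ≠ 0) (hD : D ≠ 0) (r : ℝ)
    (hDS : (D : ℝ) = S * Real.exp (-2 * r)) (k : ℝ → ℝ) (hk : Integrable k (gaussianReal v D)) :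
    Integrable (fun x => Real.exp (r + (x - m) ^ 2 / (2 * S) - (x - v) ^ 2 / (2 * D)) * k x)
      (gaussianReal m S) ∧
    ∫ x, Real.exp (r + (x - m) ^ 2 / (2 * S) - (x - v) ^ 2 / (2 * D)) * k x ∂(gaussianReal m S) =
      ∫ x, k x ∂(gaussianReal v D) := by
  constructor
  · rw [gaussianReal_of_var_ne_zero _ hS, integrable_withDensity_iff_integrable_smul'
      (measurable_gaussianPDF _ _) (ae_of_all _ fun x => gaussianPDF_lt_top)]
    rw [gaussianReal_of_var_ne_zero _ hD, integrable_withDensity_iff_integrable_smul'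
      (measurable_gaussianPDF _ _) (ae_of_all _ fun x => gaussianPDF_lt_top)] at hk
    refine hk.congr (ae_of_all _ fun x => ?_)
    simp only [toReal_gaussianPDF, smul_eq_mul]
    rw [← mul_assoc, aux_pdf m v S D hS r hDS]
  · rw [integral_gaussianReal_eq_integral_smul hS, integral_gaussianReal_eq_integral_smul hD]
    congr 1
    ext x
    simp only [smul_eq_mul]
    rw [← mul_assoc, aux_pdf m v S D hS r hDS]

lemma aux_exp_le (y : ℝ) (hy : |y| ≤ 1) : Real.exp y ≤ 1 + y + y ^ 2 := by
  have := Real.abs_exp_sub_one_sub_id_le hy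
  have := (abs_le.mp this).2
  linarith

lemma aux_step1 {Ω : Type*} [MeasurableSpace Ω] (μ : Measure Ω) [IsProbabilityMeasure μ]
    (X U : Ω → ℝ) (hX : Measurable X) (hU : Measurable U) (m : ℝ) (S D : ℝ≥0)
    (hS : S ≠ 0) (hD : D ≠ 0) (hlaw : μ.map X = gaussianReal m S) (R : ℝ≥0∞) (hR : R ≠ ⊤)
    (hI : mutInfo μ X U ≤ R) (hDS : (D : ℝ) = S * Real.exp (-2 * R.toReal))
    (v : ℝ → ℝ) (hv : Measurable v) (hV : MemLp (fun ω => v (U ω)) 2 μ)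
    (θ s c : ℝ) (hθ0 : 0 ≤ θ) (hθ1 : θ ≤ 1) :
    θ * ((∫ ω, Real.cos (s * v (U ω) + c) ∂μ) * Real.exp (-(D * s ^ 2 / 2))) ≤
      θ * Real.exp (-(S * s ^ 2 / 2)) + θ ^ 2 + ((∫ ω, (X ω - v (U ω)) ^ 2 ∂μ) - D) / (2 * D) := by
  have hS' : (0 : ℝ) < S := by positivity
  have hD' : (0 : ℝ) < D := by positivity
  have : IsProbabilityMeasure (μ.map U) := Measure.isProbabilityMeasure_map hU.aemeasurable
  set r := R.toReal with hr
  have hX2 : MemLp X 2 μ := by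
    have h := memLp_id_gaussianReal' (μ := m) (v := S) 2 (by simp)
    rw [← hlaw] at h
    exact (memLp_map_measure_iff (by fun_prop) hX.aemeasurable).mp h
  have hXm : MemLp (fun ω => X ω - m) 2 μ := hX2.sub (memLp_const m)
  have i1 : Integrable (fun ω => (X ω - m) ^ 2) μ := hXm.integrable_sq
  have i2 : Integrable (fun ω => (X ω - v (U ω)) ^ 2) μ := (hX2.sub hV).integrable_sq
  have i3 : Integrable (fun ω => Real.cos (s * X ω + c)) μ :=
    Integrable.of_bound (by fun_prop) 1 (ae_of_all _ fun x => Real.abs_cos_le_one _)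
  have i4 : Integrable (fun ω => Real.cos (s * v (U ω) + c)) μ :=
    Integrable.of_bound (Measurable.aestronglyMeasurable (by fun_prop)) 1 (ae_of_all _ fun x => Real.abs_cos_le_one _)
  have e1 : ∫ ω, (X ω - m) ^ 2 ∂μ = S := by
    have h := variance_id_gaussianReal (μ := m) (v := S)
    rw [variance_eq_integral (by fun_prop)] at h
    simp only [id, integral_id_gaussianReal] at h
    rw [← hlaw, integral_map hX.aemeasurable (by fun_prop)] at h
    exact h
  have e3 : ∫ ω, Real.cos (s * X ω + c) ∂μ = Real.cos (s * m + c) * Real.exp (-(S * s ^ 2 / 2)) := by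
    rw [← aux_cos_gauss, ← hlaw, integral_map hX.aemeasurable (by fun_prop)]
  set F : ℝ × ℝ → ℝ := fun z => (r + (z.1 - m) ^ 2 / (2 * S) - (z.1 - v z.2) ^ 2 / (2 * D)) 
    + (-θ * Real.cos (s * z.1 + c)) with hF
  have hFm : Measurable F := by fun_prop
  have hkb : ∀ x, Real.exp (-θ * Real.cos (s * x + c)) ≤ 1 - θ * Real.cos (s * x + c) + θ ^ 2 := by
    intro x
    have hc := Real.abs_cos_le_one (s * x + c)
    have hc2 := Real.cos_sq_le_one (s * x + c)
    have : |(-θ * Real.cos (s * x + c))| ≤ 1 := by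
      rw [abs_mul, abs_neg, abs_of_nonneg hθ0]
      nlinarith [abs_nonneg (Real.cos (s * x + c))]
    have h := aux_exp_le _ this
    nlinarith [mul_nonneg (sq_nonneg θ) (sub_nonneg.mpr hc2)]
  have hki : ∀ a : ℝ, Integrable (fun x => Real.exp (-θ * Real.cos (s * x + c))) (gaussianReal a D) := by
    intro a
    refine Integrable.of_bound (by fun_prop) 3 (ae_of_all _ fun x => ?_)
    rw [Real.norm_of_nonneg (Real.exp_pos _).le]
    have := hkb x
    have := (abs_le.mp (Real.abs_cos_le_one (s * x + c))).1
    nlinarith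
  have hinner : ∀ u : ℝ, Integrable (fun x => Real.exp (F (x, u))) (gaussianReal m S) ∧ 
      ∫ x, Real.exp (F (x, u)) ∂(gaussianReal m S) ≤ 
        1 - θ * (Real.cos (s * v u + c) * Real.exp (-(D * s ^ 2 / 2))) + θ ^ 2 := by
    intro u
    have h := aux_tilt m (v u) S D hS hD r hDS _ (hki (v u))
    simp only [hF, Real.exp_add _ (-θ * _)]
    refine ⟨h.1, ?_⟩
    rw [h.2, ← aux_cos_gauss]
    have ic : Integrable (fun x => Real.cos (s * x + c)) (gaussianReal (v u) D) :=
      Integrable.of_bound (by fun_prop) 1 (ae_of_all _ fun x => Real.abs_cos_le_one _)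
    calc _ ≤ ∫ x, (1 - θ * Real.cos (s * x + c) + θ ^ 2) ∂(gaussianReal (v u) D) :=
          integral_mono (hki _) (((integrable_const _).sub (ic.const_mul _)).add (integrable_const _)) hkb
      _ = _ := by
        have ic2 : Integrable (fun x => 1 - θ * Real.cos (s * x + c)) (gaussianReal (v u) D) :=
          (integrable_const _).sub (ic.const_mul _)
        rw [integral_add ic2 (integrable_const _),
          integral_sub (integrable_const _) (ic.const_mul _), integral_const_mul]
        simp
  have j4 : Integrable (fun u => 1 - θ * (Real.cos (s * v u + c) * Real.exp (-(D * s ^ 2 / 2))) + θ ^ 2)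
      (μ.map U) := by
    have : Integrable (fun u => Real.cos (s * v u + c)) (μ.map U) :=
      Integrable.of_bound (by fun_prop) 1 (ae_of_all _ fun x => Real.abs_cos_le_one _)
    exact ((integrable_const _).sub ((this.mul_const _).const_mul _)).add (integrable_const _)
  have he : Integrable (fun z => Real.exp (F z)) ((μ.map X).prod (μ.map U)) := by
    rw [hlaw]
    rw [integrable_prod_iff' (by fun_prop)]
    refine ⟨ae_of_all _ fun u => (hinner u).1, ?_⟩
    refine j4.mono' ?_ (ae_of_all _ fun u => ?_)
    · exact (StronglyMeasurable.integral_prod_left' (f := fun z => ‖Real.exp (F z)‖) 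
        (by fun_prop)).aestronglyMeasurable
    · rw [Real.norm_of_nonneg (integral_nonneg fun x => norm_nonneg _)]
      simp only [Real.norm_of_nonneg (Real.exp_pos _).le]
      exact (hinner u).2
  have hFi : Integrable (fun ω => F (X ω, U ω)) μ :=
    (((integrable_const r).add (i1.div_const _)).sub (i2.div_const _)).add (i3.const_mul (-θ))
  have hEF : ∫ ω, F (X ω, U ω) ∂μ = r + S / (2 * S) - (∫ ω, (X ω - v (U ω)) ^ 2 ∂μ) / (2 * D) 
      - θ * (Real.cos (s * m + c) * Real.exp (-(S * s ^ 2 / 2))) := by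
    simp only [hF]
    have l1 : Integrable (fun ω => r + (X ω - m) ^ 2 / (2 * S)) μ := 
      (integrable_const r).add (i1.div_const _)
    have l2 : Integrable (fun ω => r + (X ω - m) ^ 2 / (2 * S) - (X ω - v (U ω)) ^ 2 / (2 * D)) μ := 
      l1.sub (i2.div_const _)
    rw [integral_add l2 (i3.const_mul (-θ)),
      integral_sub l1 (i2.div_const _),
      integral_add (integrable_const r) (i1.div_const _), integral_div, integral_div, 
      integral_const_mul, e1, e3]
    simp
    ring
  have hEe : ∫ z, Real.exp (F z) ∂((μ.map X).prod (μ.map U)) ≤ 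
      1 - θ * ((∫ ω, Real.cos (s * v (U ω) + c) ∂μ) * Real.exp (-(D * s ^ 2 / 2))) + θ ^ 2 := by
    rw [integral_prod_symm _ he]
    rw [hlaw] at he ⊢
    calc _ ≤ ∫ u, (1 - θ * (Real.cos (s * v u + c) * Real.exp (-(D * s ^ 2 / 2))) + θ ^ 2) ∂(μ.map U) :=
          integral_mono he.integral_prod_right j4 (fun u => (hinner u).2)
      _ = _ := by
        have l1 : Integrable (fun ω => 1 - θ * (Real.cos (s * v (U ω) + c) * 
          Real.exp (-(D * s ^ 2 / 2)))) μ := (integrable_const _).sub ((i4.mul_const _).const_mul _)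
        rw [integral_map hU.aemeasurable (Measurable.aestronglyMeasurable (by fun_prop)), 
          integral_add l1 (integrable_const _),
          integral_sub (integrable_const _) ((i4.mul_const _).const_mul _), integral_const_mul,
          integral_mul_const]
        simp
  have h := aux_dv μ X U hX hU R hR hI F hFm hFi he
  rw [hEF] at h
  have hh : (S : ℝ) / (2 * S) = 1 / 2 := by field_simp
  have hd : ((∫ ω, (X ω - v (U ω)) ^ 2 ∂μ) - D) / (2 * D) = (∫ ω, (X ω - v (U ω)) ^ 2 ∂μ) / (2 * D) - 1 / 2 := by
    field_simp
  rw [hd]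
  have hcc : θ * (Real.cos (s * m + c) * Real.exp (-(S * s ^ 2 / 2))) ≤ θ * Real.exp (-(S * s ^ 2 / 2)) := by
    apply mul_le_mul_of_nonneg_left _ hθ0
    exact mul_le_of_le_one_left (Real.exp_pos _).le (Real.cos_le_one _)
  linarith

lemma aux_step2 {Ω : Type*} [MeasurableSpace Ω] (μ : Measure Ω) [IsProbabilityMeasure μ]
    (Y U : Ω → ℝ) (hY : Measurable Y) (hU : Measurable U) (C : ℝ≥0∞) (hC : C ≠ ⊤)
    (hI : mutInfo μ Y U ≤ C) (v : ℝ → ℝ) (hv : Measurable v)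
    (h2 : Integrable (fun ω => (v (U ω) - Y ω) ^ 2) μ) (ρ lam : ℝ) (hlam : 0 ≤ lam)
    (B : ℝ → ℝ) (hB : Integrable B (gaussianReal 0 1))
    (hcos : ∀ z c, ∫ ω, Real.cos (ρ * z * v (U ω) + c) ∂μ ≤ B z) :
    lam * (1 - ρ ^ 2 * (∫ ω, (v (U ω) - Y ω) ^ 2 ∂μ) / 2) 
      - (Real.exp lam - 1) * ∫ z, B z ∂(gaussianReal 0 1) ≤ C.toReal := by
  have : IsProbabilityMeasure (μ.map U) := Measure.isProbabilityMeasure_map hU.aemeasurable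
  have : IsProbabilityMeasure (μ.map Y) := Measure.isProbabilityMeasure_map hY.aemeasurable
  set G : ℝ × ℝ → ℝ := fun z => Real.exp (-(ρ ^ 2 * (v z.2 - z.1) ^ 2 / 2)) with hG
  have hGm : Measurable G := by fun_prop
  have hG0 : ∀ z, 0 ≤ G z := fun z => (Real.exp_pos _).le
  have hG1 : ∀ z, G z ≤ 1 := fun z => Real.exp_le_one_iff.mpr (by simp only [Left.neg_nonpos_iff]; positivity)
  have hGi : Integrable G ((μ.map Y).prod (μ.map U)) := 
    Integrable.of_bound hGm.aestronglyMeasurable 1 (ae_of_all _ fun x => by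
      rw [Real.norm_of_nonneg (hG0 x)]; exact hG1 x)
  have hGi' : Integrable (fun ω => G (Y ω, U ω)) μ := 
    Integrable.of_bound (hGm.comp (hY.prodMk hU)).aestronglyMeasurable 1 (ae_of_all _ fun x => by
      rw [Real.norm_of_nonneg (hG0 _)]; exact hG1 _)
  have hee : ∀ z, Real.exp (lam * G z) ≤ 1 + (Real.exp lam - 1) * G z := by
    intro z
    have h := convexOn_exp.2 (Set.mem_univ 0) (Set.mem_univ lam) (sub_nonneg.mpr (hG1 z)) (hG0 z) 
      (by ring)
    simp only [smul_eq_mul, mul_zero, zero_add, Real.exp_zero, mul_one] at h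
    rw [mul_comm lam]
    linarith
  have he : Integrable (fun z => Real.exp (lam * G z)) ((μ.map Y).prod (μ.map U)) :=
    Integrable.of_bound (by fun_prop) (Real.exp lam) (ae_of_all _ fun x => by
      rw [Real.norm_of_nonneg (Real.exp_pos _).le]
      exact Real.exp_le_exp.mpr (mul_le_of_le_one_right hlam (hG1 x)))
  have h := aux_dv μ Y U hY hU C hC hI (fun z => lam * G z) (by fun_prop) (hGi'.const_mul lam) he
  have hA : 1 - ρ ^ 2 * (∫ ω, (v (U ω) - Y ω) ^ 2 ∂μ) / 2 ≤ ∫ ω, G (Y ω, U ω) ∂μ := by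
    have : 1 - ρ ^ 2 * (∫ ω, (v (U ω) - Y ω) ^ 2 ∂μ) / 2 = 
        ∫ ω, (1 - ρ ^ 2 * (v (U ω) - Y ω) ^ 2 / 2) ∂μ := by
      rw [integral_sub (integrable_const _) ((h2.const_mul _).div_const _), integral_div, 
        integral_const_mul]
      simp
    rw [this]
    refine integral_mono ((integrable_const _).sub ((h2.const_mul _).div_const _)) hGi' fun ω => ?_
    have := Real.add_one_le_exp (-(ρ ^ 2 * (v (U ω) - Y ω) ^ 2 / 2))
    simp only [hG]
    linarith
  have hq : ∫ z, G z ∂((μ.map Y).prod (μ.map U)) ≤ ∫ z, B z ∂(gaussianReal 0 1) := by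
    rw [integral_prod _ hGi]
    have hin : ∀ y, ∫ u, G (y, u) ∂(μ.map U) ≤ ∫ z, B z ∂(gaussianReal 0 1) := by
      intro y
      have hGc : ∀ u, G (y, u) = ∫ z, Real.cos (ρ * z * v u + -(ρ * z * y)) ∂(gaussianReal 0 1) := by
        intro u
        have := aux_cos_gauss 0 1 (ρ * (v u - y)) 0
        simp only [mul_zero, add_zero, Real.cos_zero, one_mul, NNReal.coe_one] at this
        simp only [hG]
        rw [← mul_pow, ← this]
        congr 1; ext z; congr 1; ring
      simp only [hGc]
      rw [integral_integral_swap]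
      · refine integral_mono ?_ hB fun z => ?_
        · refine Integrable.of_bound ?_ 1 (ae_of_all _ fun z => ?_)
          · exact (StronglyMeasurable.integral_prod_right' (ν := μ.map U) 
              (f := fun z : ℝ × ℝ => Real.cos (ρ * z.1 * v z.2 + -(ρ * z.1 * y)))
              (Measurable.stronglyMeasurable (by fun_prop))).aestronglyMeasurable
          · refine (norm_integral_le_of_norm_le_const (C := 1) (ae_of_all _ fun u => ?_)).trans (by simp)
            exact Real.abs_cos_le_one _
        · simp only
          rw [integral_map hU.aemeasurable (by fun_prop)]
          exact hcos z _
      · refine Integrable.of_bound (Measurable.aestronglyMeasurable ?_) 1 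
          (ae_of_all _ fun z => Real.abs_cos_le_one _)
        simp only [Function.uncurry_def]
        fun_prop
    calc _ ≤ ∫ y, (∫ z, B z ∂(gaussianReal 0 1)) ∂(μ.map Y) := 
          integral_mono hGi.integral_prod_left (integrable_const _) hin
      _ = _ := by simp
  have hEe : ∫ z, Real.exp (lam * G z) ∂((μ.map Y).prod (μ.map U)) ≤ 
      1 + (Real.exp lam - 1) * ∫ z, G z ∂((μ.map Y).prod (μ.map U)) := by
    calc _ ≤ ∫ z, (1 + (Real.exp lam - 1) * G z) ∂((μ.map Y).prod (μ.map U)) :=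
          integral_mono he ((integrable_const _).add (hGi.const_mul _)) hee
      _ = _ := by
        rw [integral_add (integrable_const _) (hGi.const_mul _), integral_const_mul]; simp
  rw [integral_const_mul] at h
  have h5 := mul_le_mul_of_nonneg_left hA hlam
  have h6 := mul_le_mul_of_nonneg_left hq (sub_nonneg.mpr (Real.one_le_exp hlam))
  linarith

lemma aux_orth' {Ω : Type*} {M : MeasurableSpace Ω} {mΩ : MeasurableSpace Ω} [StandardBorelSpace Ω] 
    (hm : M ≤ mΩ) (μ : Measure Ω) 
    [IsProbabilityMeasure μ] (X Y : Ω → ℝ) (hX : Measurable X) (hY : Measurable Y)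
    (hci : CondIndepFun M hm X Y μ)
    (hX2 : MemLp X 2 μ) (hY2 : MemLp Y 2 μ) :
      ∫ ω, (X ω - Y ω) ^ 2 ∂μ = ∫ ω, (X ω - (μ[X | M]) ω) ^ 2 ∂μ + ∫ ω, ((μ[X | M]) ω - Y ω) ^ 2 ∂μ := by
  have hsm : StronglyMeasurable[M] (μ[X | M]) := stronglyMeasurable_condExp
  have hV2 : MemLp (μ[X | M]) 2 μ := hX2.condExp (by norm_num)
  set V := μ[X | M] with hVdef
  have hXi : Integrable X μ := hX2.integrable (by norm_num)
  have hYi : Integrable Y μ := hY2.integrable (by norm_num)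
  have hXY : Integrable (X * Y) μ := hX2.integrable_mul hY2
  have hVY : Integrable (V * Y) μ := hV2.integrable_mul hY2
  have hVX' : Integrable (V * X) μ := hV2.integrable_mul hX2
  have hVV : Integrable (V * V) μ := hV2.integrable_mul hV2
  have c1 : μ[V * Y | M] =ᵐ[μ] V * μ[Y | M] := condExp_mul_of_stronglyMeasurable_left hsm hVY hYi
  have c2 : μ[V * X | M] =ᵐ[μ] V * V := condExp_mul_of_stronglyMeasurable_left hsm hVX' hXi
  have c3 : μ[X * Y | M] =ᵐ[μ] V * μ[Y | M] := by
    have k := ae_of_ae_trim hm ((condIndepFun_iff_map_prod_eq_prod_map_map hX hY).mp hci)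
    have k1 := condExp_ae_eq_integral_condExpKernel hm hXY
    have k2 := condExp_ae_eq_integral_condExpKernel hm hXi
    have k3 := condExp_ae_eq_integral_condExpKernel hm hYi
    filter_upwards [k, k1, k2, k3] with ω h h1 h2 h3
    rw [h1, Pi.mul_apply, hVdef, h2, h3]
    rw [Kernel.map_apply _ (hX.prodMk hY), Kernel.prod_apply, Kernel.map_apply _ hX, Kernel.map_apply _ hY] at h
    have hind : IndepFun X Y (condExpKernel μ M ω) := 
      (indepFun_iff_map_prod_eq_prod_map_map hX.aemeasurable hY.aemeasurable).mpr h
    exact hind.integral_mul_eq_mul_integral hX.aestronglyMeasurable hY.aestronglyMeasurable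
  have d1 : ∫ ω, (X * Y) ω ∂μ = ∫ ω, (V * Y) ω ∂μ := by
    rw [← integral_condExp hm (f := X * Y), ← integral_condExp hm (f := V * Y)]
    exact integral_congr_ae (c3.trans c1.symm)
  have d2 : ∫ ω, (V * X) ω ∂μ = ∫ ω, (V * V) ω ∂μ := by
    rw [← integral_condExp hm (f := V * X)]
    exact integral_congr_ae c2
  have e : ∀ ω, (X ω - Y ω) ^ 2 = ((X ω - V ω) ^ 2 + (V ω - Y ω) ^ 2) + 
      2 * (((V * X) ω - (V * V) ω) - ((X * Y) ω - (V * Y) ω)) := by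
    intro ω; simp only [Pi.mul_apply]; ring
  simp only [e]
  have j1 : Integrable (fun ω => (X ω - V ω) ^ 2) μ := (hX2.sub hV2).integrable_sq
  have j2 : Integrable (fun ω => (V ω - Y ω) ^ 2) μ := (hV2.sub hY2).integrable_sq
  have j3 : Integrable (fun ω => (X ω - V ω) ^ 2 + (V ω - Y ω) ^ 2) μ := j1.add j2
  have j4 : Integrable (fun ω => (V * X) ω - (V * V) ω) μ := hVX'.sub hVV
  have j5 : Integrable (fun ω => (X * Y) ω - (V * Y) ω) μ := hXY.sub hVY
  have j6 : Integrable (fun ω => 2 * (((V * X) ω - (V * V) ω) - ((X * Y) ω - (V * Y) ω))) μ := 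
    (j4.sub j5).const_mul 2
  rw [integral_add j3 j6, integral_add j1 j2,
    integral_const_mul, integral_sub j4 j5, integral_sub hVX' hVV, 
    integral_sub hXY hVY, d1, d2]
  ring

lemma aux_orth {Ω : Type*} [mΩ : MeasurableSpace Ω] [StandardBorelSpace Ω] (μ : Measure Ω) 
    [IsProbabilityMeasure μ] (X U Y : Ω → ℝ) (hX : Measurable X) (hU : Measurable U) (hY : Measurable Y)
    (hci : CondIndepFun (MeasurableSpace.comap U inferInstance) hU.comap_le X Y μ)
    (hX2 : MemLp X 2 μ) (hY2 : MemLp Y 2 μ) :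
    ∃ v : ℝ → ℝ, Measurable v ∧ MemLp (fun ω => v (U ω)) 2 μ ∧
      ∫ ω, (X ω - Y ω) ^ 2 ∂μ = ∫ ω, (X ω - v (U ω)) ^ 2 ∂μ + ∫ ω, (v (U ω) - Y ω) ^ 2 ∂μ := by
  have hsm : StronglyMeasurable[MeasurableSpace.comap U inferInstance] 
    (μ[X | MeasurableSpace.comap U inferInstance]) := stronglyMeasurable_condExp
  obtain ⟨v, hv, hvU⟩ := StronglyMeasurable.exists_eq_measurable_comp hsm
  have hVX : (fun ω => v (U ω)) = μ[X | MeasurableSpace.comap U inferInstance] := by rw [hvU]; rfl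
  have hV2 : MemLp (μ[X | MeasurableSpace.comap U inferInstance]) 2 μ := hX2.condExp (by norm_num)
  refine ⟨v, hv.measurable, by rw [hVX]; exact hV2, ?_⟩
  have hpt : ∀ ω, v (U ω) = (μ[X | MeasurableSpace.comap U inferInstance]) ω := fun ω => congrFun hVX ω
  simp only [hpt]
  exact aux_orth' hU.comap_le μ X Y hX hY hci hX2 hY2

lemma aux_gap (m : ℝ) (S D : ℝ≥0) (hS : S ≠ 0) (hD : D ≠ 0) (R Rc : ℝ≥0∞) 
    (hR : 0 < R) (hRtop : R ≠ ⊤) (hRc : Rc ≠ ⊤) (hDS : (D : ℝ) = S * Real.exp (-2 * R.toReal)) :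
    ∃ ε : ℝ, 0 < ε ∧ ∀ μ : Measure (ℝ × ℝ × ℝ), 
      DRPfeasible (gaussianReal m S) (fun _ _ => 0) R Rc ⊤ μ → 
        ENNReal.ofReal (D + ε) ≤ distortion μ := by
  have hS' : (0 : ℝ) < S := by positivity
  have hD' : (0 : ℝ) < D := by positivity
  have hr : 0 < R.toReal := ENNReal.toReal_pos hR.ne' hRtop
  have hC : R + Rc ≠ ⊤ := ENNReal.add_ne_top.mpr ⟨hRtop, hRc⟩
  have hκ : (0 : ℝ) < S - D := by
    rw [hDS]
    have : Real.exp (-2 * R.toReal) < 1 := by rw [← Real.exp_zero]; exact Real.exp_lt_exp.mpr (by linarith)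
    nlinarith
  set lam := (R + Rc).toReal + 2 with hlam
  have hlam2 : 2 ≤ lam := by rw [hlam]; linarith [ENNReal.toReal_nonneg (a := R + Rc)]
  obtain ⟨ρ, hρ, τ, hτ, hQ⟩ := aux_choose (S - D) D (Real.exp (-lam)) hκ (Real.exp_pos _)
  set θ := min (τ / 2) 1 with hθ
  have hθ0 : 0 < θ := by positivity
  have hθ1 : θ ≤ 1 := min_le_right _ _
  have hθτ : θ ≤ τ / 2 := min_le_left _ _
  set ε := min (D * θ * τ) (1 / (lam * ρ ^ 2)) with hε
  have hl0 : 0 < lam := by linarith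
  have hε0 : 0 < ε := by positivity
  have hε1 : ε ≤ D * θ * τ := min_le_left _ _
  have hε2 : ε ≤ 1 / (lam * ρ ^ 2) := min_le_right _ _
  refine ⟨ε, hε0, fun μ hμ => ?_⟩
  by_contra hlt
  push Not at hlt
  obtain ⟨hprob, hlaw, hci, hI1, hI2, -⟩ := hμ
  have hXm : Measurable (fun w : ℝ × ℝ × ℝ => w.1) := by fun_prop
  have hUm : Measurable (fun w : ℝ × ℝ × ℝ => w.2.1) := by fun_prop
  have hYm : Measurable (fun w : ℝ × ℝ × ℝ => w.2.2) := by fun_prop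
  have hX2 : MemLp (fun w : ℝ × ℝ × ℝ => w.1) 2 μ := by
    have h := memLp_id_gaussianReal' (μ := m) (v := S) 2 (by simp)
    rw [← hlaw] at h
    exact (memLp_map_measure_iff (by fun_prop) hXm.aemeasurable).mp h
  have hXYi : Integrable (fun w : ℝ × ℝ × ℝ => (w.1 - w.2.2) ^ 2) μ := by
    refine ⟨by fun_prop, ?_⟩
    rw [hasFiniteIntegral_iff_ofReal (ae_of_all _ fun w => sq_nonneg _)]
    exact hlt.trans ENNReal.ofReal_lt_top
  have hXY2 : MemLp (fun w : ℝ × ℝ × ℝ => w.1 - w.2.2) 2 μ := 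
    (memLp_two_iff_integrable_sq (by fun_prop)).mpr hXYi
  have hY2 : MemLp (fun w : ℝ × ℝ × ℝ => w.2.2) 2 μ := by
    have := hX2.sub hXY2
    refine this.congr_norm (by fun_prop) (ae_of_all _ fun w => ?_)
    simp
  have hd : ∫ w, (w.1 - w.2.2) ^ 2 ∂μ < D + ε := by
    unfold distortion at hlt
    rw [← ofReal_integral_eq_lintegral_ofReal hXYi (ae_of_all _ fun w => sq_nonneg _)] at hlt
    exact (ENNReal.ofReal_lt_ofReal_iff (by positivity)).mp hlt
  obtain ⟨v, hv, hV2, hpy⟩ := aux_orth μ _ _ _ hXm hUm hYm hci hX2 hY2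
  set a := ∫ w, (w.1 - v w.2.1) ^ 2 ∂μ with ha
  set b := ∫ w, (v w.2.1 - w.2.2) ^ 2 ∂μ with hb
  have hb0 : 0 ≤ b := integral_nonneg fun _ => sq_nonneg _
  have st1 := aux_step1 μ _ _ hXm hUm m S D hS hD hlaw R hRtop hI1 hDS v hv hV2
  have haD : (D : ℝ) ≤ a := by
    have h := st1 0 0 0 le_rfl zero_le_one
    rw [← ha] at h
    simp only [zero_mul, zero_add, ne_eq, OfNat.ofNat_ne_zero, not_false_eq_true, zero_pow] at h
    by_contra hn
    push Not at hn
    have : (a - D) / (2 * D) < 0 := div_neg_of_neg_of_pos (by linarith) (by positivity)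
    linarith
  have hbε : b < ε := by linarith
  have haε : a - D < ε := by linarith
  have hcos : ∀ z c, ∫ w, Real.cos (ρ * z * v w.2.1 + c) ∂μ ≤ 
      min 1 (Real.exp (-((S - D : ℝ) * (ρ * z) ^ 2 / 2)) + τ * Real.exp (D * (ρ * z) ^ 2 / 2)) := by
    intro z c
    refine le_min ?_ ?_
    · calc _ ≤ ∫ w : ℝ × ℝ × ℝ, (1 : ℝ) ∂μ := by
            refine integral_mono (Integrable.of_bound (Measurable.aestronglyMeasurable (by fun_prop)) 1
              (ae_of_all _ fun x => Real.abs_cos_le_one _)) (integrable_const _) 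
              fun w => Real.cos_le_one _
        _ = 1 := by simp
    · have h := st1 θ (ρ * z) c hθ0.le hθ1
      rw [← ha] at h
      set K := ∫ w, Real.cos (ρ * z * v w.2.1 + c) ∂μ with hK
      have h1 : (a - D) / (2 * D) ≤ θ * (τ / 2) := by
        rw [div_le_iff₀ (by positivity)]; nlinarith
      have h2 : θ * (K * Real.exp (-(D * (ρ * z) ^ 2 / 2))) ≤ 
          θ * (Real.exp (-(S * (ρ * z) ^ 2 / 2)) + τ) := by nlinarith
      have h3 := le_of_mul_le_mul_left h2 hθ0
      have h4 := mul_le_mul_of_nonneg_right h3 (Real.exp_pos (D * (ρ * z) ^ 2 / 2)).le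
      rw [mul_assoc, ← Real.exp_add, neg_add_cancel, Real.exp_zero, mul_one, add_mul, 
        ← Real.exp_add] at h4
      convert h4 using 3
      ring
  have hBi : Integrable (fun z => min 1 (Real.exp (-((S - D : ℝ) * (ρ * z) ^ 2 / 2)) + 
      τ * Real.exp (D * (ρ * z) ^ 2 / 2))) (gaussianReal 0 1) := by
    refine Integrable.of_bound (by fun_prop) 1 (ae_of_all _ fun z => ?_)
    rw [Real.norm_of_nonneg (by positivity)]
    exact min_le_left _ _
  have st2 := aux_step2 μ _ _ hYm hUm (R + Rc) hC hI2 v hv (hV2.sub hY2).integrable_sq ρ lam hl0.le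
    _ hBi hcos
  rw [← hb] at st2
  have h7 : (Real.exp lam - 1) * ∫ z, min 1 (Real.exp (-((S - D : ℝ) * (ρ * z) ^ 2 / 2)) + 
      τ * Real.exp (D * (ρ * z) ^ 2 / 2)) ∂(gaussianReal 0 1) ≤ 1 := by
    calc _ ≤ (Real.exp lam - 1) * Real.exp (-lam) := 
          mul_le_mul_of_nonneg_left hQ (sub_nonneg.mpr (Real.one_le_exp hl0.le))
      _ = 1 - Real.exp (-lam) := by rw [sub_mul, ← Real.exp_add]; simp
      _ ≤ 1 := by linarith [Real.exp_pos (-lam)]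
  have h8 : lam * (ρ ^ 2 * b / 2) ≤ 1 / 2 := by
    have : b ≤ 1 / (lam * ρ ^ 2) := hbε.le.trans hε2
    rw [le_div_iff₀ (by positivity)] at this
    linarith
  linarith

/-- `D(R, R_c, ∞) > σ_X² e^{-2R}` for Gaussian sources, `R ∈ (0,∞)`, `R_c ∈ [0,∞)`. -/
theorem stmt16 (μX σX : ℝ) (hσX : 0 < σX) (R Rc : ℝ≥0∞)
    (hR : 0 < R) (hRtop : R ≠ ⊤) (hRc : Rc ≠ ⊤) :
    DRPinf (gauss μX σX) R Rc > ENNReal.ofReal (σX ^ 2 * expNeg (2 * R)) := by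
  have hexp : expNeg (2 * R) = Real.exp (-2 * R.toReal) := by
    unfold expNeg
    rw [if_neg (ENNReal.mul_ne_top (by simp) hRtop), ENNReal.toReal_mul]
    simp
  have hp : 0 < σX ^ 2 * Real.exp (-2 * R.toReal) := by positivity
  obtain ⟨ε, hε, h⟩ := aux_gap μX ⟨σX ^ 2, sq_nonneg σX⟩ ⟨σX ^ 2 * Real.exp (-2 * R.toReal), hp.le⟩
    (fun h0 => (pow_pos hσX 2).ne' (congrArg NNReal.toReal h0)) 
    (fun h0 => hp.ne' (congrArg NNReal.toReal h0)) R Rc hR hRtop hRc rfl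
  rw [hexp]
  unfold DRPinf DRP
  refine lt_of_lt_of_le ?_ (le_iInf₂ h)
  exact (ENNReal.ofReal_lt_ofReal_iff (add_pos hp hε)).mpr (lt_add_of_pos_right _ hε)
end

section
/- Let p_X be the Gaussian distribution N(μ_X, σ_X²) with σ_X > 0, and let R ∈ (0,∞) and R_c ∈ [0,∞). Then the entropy-constrained quantization function satisfies the strict inequality D_e(R,R_c) > σ_X² e^{−2R}. -/
open MeasureTheory ProbabilityTheory Real Set
open scoped ENNReal NNReal

lemma KLD_le_iff' {α : Type*} [MeasurableSpace α] {q p : Measure α} {R : ℝ≥0∞} (hR : R ≠ ⊤)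
    (h : KLD q p ≤ R) : q ≪ p ∧ Integrable (fun x => Real.log (q.rnDeriv p x).toReal) q ∧
      ∫ x, Real.log (q.rnDeriv p x).toReal ∂q ≤ R.toReal := by
  unfold KLD at h
  split_ifs at h with hc
  · refine ⟨hc.1, hc.2, ?_⟩
    exact (ENNReal.ofReal_le_iff_le_toReal hR).1 h
  · exact absurd (top_le_iff.1 h) hR

lemma atom_pointwise (g L : ℝ) (hg : 0 ≤ g) :
    -(g * Real.log g) ≤ Real.exp L * (if g = 0 then 0 else 1) - g * (1 + L) := by
  rcases hg.eq_or_lt with h | h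
  · subst h; simp
  · rw [if_neg h.ne']
    have := Real.add_one_le_exp (L - Real.log g)
    rw [Real.exp_sub, Real.exp_log h] at this
    have h2 : g * (L - Real.log g + 1) ≤ g * (Real.exp L / g) :=
      mul_le_mul_of_nonneg_left this h.le
    rw [mul_div_cancel₀ _ h.ne'] at h2
    linarith

lemma exists_atom (ν : Measure ℝ) [IsProbabilityMeasure ν] (H : ℝ≥0∞) (hH : H ≠ ⊤)
    (h : KLD (ν.map (fun y => (y, y))) (ν.prod ν) ≤ H) :
    ∃ y, Real.exp (-H.toReal) / 2 ≤ ν.real {y} := by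
  obtain ⟨hac, hlogInt, hle⟩ := KLD_le_iff' hH h
  set Δ := ν.map (fun y => (y, y)) with hΔ
  have hmeas : Measurable (fun y : ℝ => (y, y)) := by fun_prop
  have : IsProbabilityMeasure Δ := Measure.isProbabilityMeasure_map hmeas.aemeasurable
  set M := ν.prod ν with hM
  set g : ℝ × ℝ → ℝ := fun w => (Δ.rnDeriv M w).toReal with hg
  have hgm : Measurable g := (Measure.measurable_rnDeriv _ _).ennreal_toReal
  have hgi : Integrable g M := Measure.integrable_toReal_rnDeriv
  have hg1 : ∫ w, g w ∂M = 1 := by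
    rw [Measure.integral_toReal_rnDeriv hac]; simp
  have hi2 : Integrable (fun w => g w * Real.log (g w)) M := by
    have := (integrable_rnDeriv_smul_iff (μ := Δ) (ν := M) hac (f := fun w => Real.log (g w))).2 hlogInt
    simpa [smul_eq_mul] using this
  have he2 : ∫ w, g w * Real.log (g w) ∂M = ∫ w, Real.log (g w) ∂Δ := by
    have := integral_rnDeriv_smul (μ := Δ) (ν := M) hac (f := fun w => Real.log (g w))
    simpa [smul_eq_mul] using this
  have hdm : MeasurableSet (Set.diagonal ℝ) := measurableSet_diagonal
  -- g vanishes off the diagonal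
  have hoff : ∀ᵐ w ∂M, w ∉ Set.diagonal ℝ → g w = 0 := by
    have h0 : Δ (Set.diagonal ℝ)ᶜ = 0 := by
      rw [hΔ, Measure.map_apply hmeas hdm.compl]
      convert measure_empty (μ := ν)
      ext y; simp
    rw [← Measure.setLIntegral_rnDeriv hac, 
      setLIntegral_eq_zero_iff hdm.compl (Measure.measurable_rnDeriv _ _)] at h0
    filter_upwards [h0] with w hw hw2
    simp [hg, hw hw2]
  have hkey : -H.toReal ≤ Real.exp H.toReal * M.real (Set.diagonal ℝ) - (1 + H.toReal) := by
    have hindi : Integrable (fun w => Real.exp H.toReal * (Set.diagonal ℝ).indicator (fun _ => (1:ℝ)) w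
        - g w * (1 + H.toReal)) M :=
      (((integrable_const (1:ℝ)).indicator hdm).const_mul _).sub (hgi.mul_const _)
    have hmono : ∫ w, -(g w * Real.log (g w)) ∂M ≤
        ∫ w, (Real.exp H.toReal * (Set.diagonal ℝ).indicator (fun _ => (1:ℝ)) w
        - g w * (1 + H.toReal)) ∂M := by
      refine integral_mono_ae hi2.neg hindi ?_
      filter_upwards [hoff] with w hw
      refine (atom_pointwise (g w) H.toReal ENNReal.toReal_nonneg).trans ?_
      gcongr
      by_cases hwd : w ∈ Set.diagonal ℝ
      · rw [Set.indicator_of_mem hwd]; split_ifs <;> norm_num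
      · rw [Set.indicator_of_notMem hwd, if_pos (hw hwd)]
    rw [integral_neg, he2, integral_sub ((((integrable_const (1:ℝ)).indicator hdm).const_mul _))
      (hgi.mul_const _), integral_const_mul, integral_mul_const, hg1, integral_indicator hdm] at hmono
    simp only [integral_const, smul_eq_mul, mul_one, one_mul, measureReal_restrict_apply_univ] at hmono
    linarith
  by_contra hcon
  push Not at hcon
  have hMle : M.real (Set.diagonal ℝ) ≤ Real.exp (-H.toReal) / 2 := by
    rw [measureReal_def]
    refine ENNReal.toReal_le_of_le_ofReal (by positivity) ?_
    rw [hM, Measure.prod_apply hdm]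
    calc ∫⁻ x, ν (Prod.mk x ⁻¹' Set.diagonal ℝ) ∂ν ≤ ∫⁻ x, ENNReal.ofReal (Real.exp (-H.toReal) / 2) ∂ν := by
          refine lintegral_mono fun x => ?_
          have : Prod.mk x ⁻¹' Set.diagonal ℝ = {x} := by
            ext y; simp [eq_comm]
          rw [this, ← ofReal_measureReal]
          exact ENNReal.ofReal_le_ofReal (hcon x).le
      _ = _ := by simp
  have : Real.exp H.toReal * M.real (Set.diagonal ℝ) ≤ 1/2 := by
    calc _ ≤ Real.exp H.toReal * (Real.exp (-H.toReal) / 2) := by gcongr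
      _ = 1/2 := by rw [mul_div_assoc', ← Real.exp_add]; simp
  linarith

lemma kl_pointwise (r q l : ℝ) (hr : 0 ≤ r) (hq : 0 < q) (hl : 0 < l) :
    |r - q| ≤ l * q + (1 + 1 / l) * (r * Real.log r - r * Real.log q + q - r) := by
  have h1 : (√r - √q) ^ 2 ≤ r * Real.log r - r * Real.log q + q - r := by
    rcases hr.eq_or_lt with h | h
    · subst h; simp [Real.sq_sqrt hq.le]
    · have hsr := Real.sqrt_pos.2 h
      have hsq := Real.sqrt_pos.2 hq
      have h2 := Real.log_le_sub_one_of_pos (div_pos hsq hsr)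
      rw [Real.log_div hsq.ne' hsr.ne', Real.log_sqrt hq.le, Real.log_sqrt h.le] at h2
      have h3 : r * (Real.log q / 2 - Real.log r / 2) ≤ r * (√q / √r - 1) :=
        mul_le_mul_of_nonneg_left h2 h.le
      have h4 : r * (√q / √r) = √r * √q := by
        field_simp; rw [Real.sq_sqrt h.le]
      have h5 := Real.sq_sqrt h.le
      have h6 := Real.sq_sqrt hq.le
      nlinarith
  have h2 : |r - q| ≤ l * q + (1 + 1 / l) * (√r - √q) ^ 2 := by
    obtain ⟨a, ha, rfl⟩ : ∃ a, 0 ≤ a ∧ r = a ^ 2 := ⟨√r, Real.sqrt_nonneg _, (Real.sq_sqrt hr).symm⟩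
    obtain ⟨b, hb, rfl⟩ : ∃ a, 0 ≤ a ∧ q = a ^ 2 := ⟨√q, Real.sqrt_nonneg _, (Real.sq_sqrt hq.le).symm⟩
    rw [Real.sqrt_sq ha, Real.sqrt_sq hb]
    have e1 : l * b ^ 2 + (1 + 1 / l) * (a - b) ^ 2 = (a-b)^2 + (l * b - (a - b)) ^ 2 / l + 2 * b * (a - b) := by
      field_simp; ring
    have e2 : l * b ^ 2 + (1 + 1 / l) * (a - b) ^ 2 = (a-b)^2 + (l * b + (a - b)) ^ 2 / l - 2 * b * (a - b) := by
      field_simp; ring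
    have p1 : 0 ≤ (l * b - (a - b)) ^ 2 / l := by positivity
    have p2 : 0 ≤ (l * b + (a - b)) ^ 2 / l := by positivity
    rw [abs_le]; constructor
    · rw [e2]; nlinarith [sq_nonneg (a-b)]
    · rw [e1]; nlinarith
  refine h2.trans ?_
  gcongr

lemma atom_le_charFun (ν : Measure ℝ) [IsProbabilityMeasure ν] (y s : ℝ) :
    ν.real {y} ≤ ∫ t, ‖charFun ν (s * t)‖ ∂(gaussianReal 0 1) := by
  set γ := gaussianReal 0 1 with hγ
  have hF : Integrable (Function.uncurry fun (t x : ℝ) => Complex.exp ((s * t * (x - y) : ℝ) * Complex.I))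
      (γ.prod ν) := by
    refine Integrable.of_bound (C := 1) (by fun_prop) ?_
    filter_upwards with w
    simp only [Function.uncurry]
    rw [Complex.norm_exp_ofReal_mul_I]
  have hswap := integral_integral_swap hF
  have h1 : ∀ x : ℝ, ∫ t : ℝ, Complex.exp ((s * t * (x - y) : ℝ) * Complex.I) ∂γ
      = ((Real.exp (-(s * (x - y)) ^ 2 / 2) : ℝ) : ℂ) := by
    intro x
    have := charFun_gaussianReal (μ := 0) (v := 1) (s * (x - y))
    rw [charFun_apply_real] at this
    push_cast at this ⊢
    rw [← hγ] at this
    have e : ∀ t : ℝ, Complex.exp (↑s * ↑t * (↑x - ↑y) * Complex.I) =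
       Complex.exp (↑s * (↑x - ↑y) * ↑t * Complex.I) := fun t => by congr 1; ring
    simp_rw [e, this]
    congr 1; simp; ring
  have h2 : ∀ t : ℝ, ∫ x : ℝ, Complex.exp ((s * t * (x - y) : ℝ) * Complex.I) ∂ν
      = charFun ν (s * t) * Complex.exp ((-(s * t * y) : ℝ) * Complex.I) := by
    intro t
    rw [charFun_apply_real, ← integral_mul_const]
    congr 1 with x
    rw [← Complex.exp_add]
    congr 1; push_cast; ring
  simp_rw [h1, h2] at hswap
  rw [integral_complex_ofReal] at hswap
  have hi : Integrable (fun x => Real.exp (-(s * (x - y)) ^ 2 / 2)) ν := by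
    refine Integrable.of_bound (C := 1) (by fun_prop) ?_
    filter_upwards with x
    rw [Real.norm_of_nonneg (Real.exp_pos _).le, Real.exp_le_one_iff]
    nlinarith [sq_nonneg (s * (x - y))]
  have h3 : ν.real {y} ≤ ∫ x, Real.exp (-(s * (x - y)) ^ 2 / 2) ∂ν := by
    calc ν.real {y} = ∫ x, ({y} : Set ℝ).indicator (fun _ => (1:ℝ)) x ∂ν := by
          rw [integral_indicator (measurableSet_singleton y)]; simp [measureReal_def]
      _ ≤ _ := by
          refine integral_mono ((integrable_const _).indicator (measurableSet_singleton y)) hi fun x => ?_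
          by_cases hx : x = y
          · subst hx; simp
          · rw [Set.indicator_of_notMem (by simpa using hx)]; positivity
  refine h3.trans ?_
  refine (le_abs_self _).trans ?_
  rw [← Real.norm_eq_abs, ← Complex.norm_real, ← hswap]
  refine (norm_integral_le_integral_norm _).trans_eq ?_
  congr 1 with t
  rw [norm_mul, Complex.norm_exp_ofReal_mul_I, mul_one]

noncomputable def qf (m : ℝ) (v D : ℝ≥0) (r : ℝ) (x y : ℝ) : ℝ :=
  Real.exp (r - (x - y) ^ 2 / (2 * D) + (x - m) ^ 2 / (2 * v))

lemma gaussian_eq_withDensity (m : ℝ) (v D : ℝ≥0) (r : ℝ) (hv : v ≠ 0)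
    (hD : (D : ℝ) = v * Real.exp (-(2 * r))) (y : ℝ) :
    (gaussianReal m v).withDensity (fun x => ENNReal.ofReal (qf m v D r x y)) = gaussianReal y D := by
  have hv0 : (0:ℝ) < v := by positivity
  have hD0 : D ≠ 0 := by
    rintro rfl
    have : 0 < (v:ℝ) * Real.exp (-(2 * r)) := by positivity
    simp at hD; linarith
  rw [gaussianReal_of_var_ne_zero _ hv, gaussianReal_of_var_ne_zero _ hD0,
    ← withDensity_mul _ (measurable_gaussianPDF _ _) (by unfold qf; fun_prop)]
  congr 1 with x
  simp only [Pi.mul_apply, gaussianPDF]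
  rw [← ENNReal.ofReal_mul (gaussianPDFReal_nonneg _ _ _)]
  congr 1
  unfold gaussianPDFReal qf
  have hs : √(2 * π * D) = √(2 * π * v) * Real.exp (-r) := by
    rw [hD, ← mul_assoc, Real.sqrt_mul (by positivity)]
    congr 1
    rw [show -(2 * r) = -r + -r by ring, Real.exp_add, Real.sqrt_mul_self (Real.exp_pos _).le]
  rw [hs, mul_inv, ← Real.exp_neg, neg_neg, mul_assoc (_)⁻¹, mul_assoc (_)⁻¹, ← Real.exp_add,
    ← Real.exp_add]
  congr 2
  ring

lemma charFun_close (m : ℝ) (v D : ℝ≥0) (r : ℝ) (hv : v ≠ 0)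
    (hD : (D : ℝ) = v * Real.exp (-(2 * r))) (J : Measure (ℝ × ℝ)) [IsProbabilityMeasure J]
    (hfst : J.map Prod.fst = gaussianReal m v) (R : ℝ≥0∞) (hR : R ≠ ⊤) (hr : R.toReal = r)
    (hKL : KLD J ((J.map Prod.fst).prod (J.map Prod.snd)) ≤ R) (e l : ℝ) (hl : 0 < l) (he : 0 ≤ e)
    (hd : ∫⁻ w, ENNReal.ofReal ((w.1 - w.2) ^ 2) ∂J ≤ ENNReal.ofReal (D * (1 + 2 * e))) (t : ℝ) :
    ‖charFun (gaussianReal m v) t - charFun (J.map Prod.snd) t * Complex.exp (-(D * t ^ 2 / 2 : ℝ))‖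
      ≤ l + (1 + 1 / l) * e := by
  obtain ⟨hac, hlogInt, hle⟩ := KLD_le_iff' hR hKL
  rw [hr] at hle
  rw [hfst] at hac hlogInt hle
  have hv0 : (0:ℝ) < v := by positivity
  have hD0 : (0:ℝ) < D := by rw [hD]; positivity
  set ν := J.map Prod.snd with hν
  have : IsProbabilityMeasure ν := Measure.isProbabilityMeasure_map measurable_snd.aemeasurable
  set M := (gaussianReal m v).prod ν with hM
  set ρ : ℝ × ℝ → ℝ := fun w => (J.rnDeriv M w).toReal with hρ
  set q : ℝ × ℝ → ℝ := fun w => qf m v D r w.1 w.2 with hq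
  have hqm : Measurable q := by unfold q qf; fun_prop
  have hqpos : ∀ w, 0 < q w := fun w => Real.exp_pos _
  have hρi : Integrable ρ M := Measure.integrable_toReal_rnDeriv
  have hρ1 : ∫ w, ρ w ∂M = 1 := by
    rw [Measure.integral_toReal_rnDeriv hac]; simp
  have hqly : ∀ y, ∫⁻ x, ENNReal.ofReal (q (x, y)) ∂(gaussianReal m v) = 1 := by
    intro y
    have := congrArg (fun μ => μ Set.univ) (gaussian_eq_withDensity m v D r hv hD y)
    simpa using this
  have hql : ∫⁻ w, ENNReal.ofReal (q w) ∂M = 1 := by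
    rw [hM, lintegral_prod_symm _ (by fun_prop)]
    simp_rw [hqly]; simp
  have hqi : Integrable q M := by
    refine ⟨hqm.aestronglyMeasurable, ?_⟩
    rw [hasFiniteIntegral_iff_ofReal (ae_of_all _ fun w => (hqpos w).le), hql]
    simp
  have hq1 : ∫ w, q w ∂M = 1 := by
    rw [integral_eq_lintegral_of_nonneg_ae (ae_of_all _ fun w => (hqpos w).le)
      hqm.aestronglyMeasurable, hql]; simp
  -- log q is J-integrable
  have hd1i : Integrable (fun w : ℝ × ℝ => (w.1 - w.2) ^ 2) J := by
    refine ⟨by fun_prop, ?_⟩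
    rw [hasFiniteIntegral_iff_ofReal (ae_of_all _ fun w => sq_nonneg _)]
    exact hd.trans_lt ENNReal.ofReal_lt_top
  have hd1 : ∫ w : ℝ × ℝ, (w.1 - w.2) ^ 2 ∂J ≤ D * (1 + 2 * e) := by
    rw [integral_eq_lintegral_of_nonneg_ae (ae_of_all _ fun w => sq_nonneg _) (by fun_prop)]
    exact ENNReal.toReal_le_of_le_ofReal (by positivity) hd
  have hgi : Integrable (fun x : ℝ => (x - m) ^ 2) (gaussianReal m v) := by
    have := (memLp_id_gaussianReal (μ := m) (v := v) 2).sub (memLp_const m)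
    exact this.integrable_sq
  have hd2i : Integrable (fun w : ℝ × ℝ => (w.1 - m) ^ 2) J := by
    have := hgi
    rw [← hfst] at this
    exact this.comp_measurable measurable_fst
  have hd2 : ∫ w : ℝ × ℝ, (w.1 - m) ^ 2 ∂J = v := by
    have h := variance_fun_id_gaussianReal (μ := m) (v := v)
    rw [variance_eq_integral measurable_id'.aemeasurable] at h
    simp only [integral_id_gaussianReal] at h
    rw [← hfst, integral_map measurable_fst.aemeasurable (by fun_prop)] at h
    exact h
  have hlogq : ∀ w, Real.log (q w) = r - (w.1 - w.2) ^ 2 / (2 * D) + (w.1 - m) ^ 2 / (2 * v) :=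
    fun w => Real.log_exp _
  have hlqi : Integrable (fun w => Real.log (q w)) J := by
    simp_rw [hlogq]
    exact ((integrable_const r).sub (hd1i.div_const _)).add (hd2i.div_const _)
  have hlq : r - e ≤ ∫ w, Real.log (q w) ∂J := by
    simp_rw [hlogq]
    have hs : Integrable (fun w : ℝ × ℝ => r - (w.1 - w.2) ^ 2 / (2 * D)) J :=
      (integrable_const r).sub (hd1i.div_const _)
    rw [integral_add hs (hd2i.div_const _),
      integral_sub (integrable_const r) (hd1i.div_const _), integral_div, integral_div, hd2]
    simp only [integral_const, probReal_univ, one_smul]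
    have h1 : (∫ w : ℝ × ℝ, (w.1 - w.2) ^ 2 ∂J) / (2 * D) ≤ 1 / 2 + e := by
      rw [div_le_iff₀ (by positivity)]; linarith
    have h2 : (v : ℝ) / (2 * v) = 1 / 2 := by field_simp
    linarith
  have tr : ∀ f : ℝ × ℝ → ℝ, Integrable f J → Integrable (fun w => ρ w * f w) M := by
    intro f hf
    have := (integrable_rnDeriv_smul_iff (μ := J) (ν := M) hac (f := f)).2 hf
    simpa [smul_eq_mul] using this
  have tr2 : ∀ f : ℝ × ℝ → ℝ, ∫ w, ρ w * f w ∂M = ∫ w, f w ∂J := by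
    intro f
    have := integral_rnDeriv_smul (μ := J) (ν := M) hac (f := f)
    simpa [smul_eq_mul] using this
  have hAi : Integrable (fun w => ρ w * Real.log (ρ w)) M := tr _ hlogInt
  have hBi : Integrable (fun w => ρ w * Real.log (q w)) M := tr _ hlqi
  have hABi : Integrable (fun w => ρ w * Real.log (ρ w) - ρ w * Real.log (q w)) M := hAi.sub hBi
  have hABq : Integrable (fun w => ρ w * Real.log (ρ w) - ρ w * Real.log (q w) + q w) M :=
    hABi.add hqi
  have hki : Integrable (fun w => ρ w * Real.log (ρ w) - ρ w * Real.log (q w) + q w - ρ w) M :=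
    hABq.sub hρi
  have hk : ∫ w, (ρ w * Real.log (ρ w) - ρ w * Real.log (q w) + q w - ρ w) ∂M ≤ e := by
    have hle' : ∫ w, Real.log (ρ w) ∂J ≤ r := hle
    rw [integral_sub hABq hρi, integral_add hABi hqi,
      integral_sub hAi hBi, tr2, tr2, hq1, hρ1]
    linarith
  have htv : ∫ w, |ρ w - q w| ∂M ≤ l + (1 + 1 / l) * e := by
    calc _ ≤ ∫ w, (l * q w + (1 + 1 / l) *
          (ρ w * Real.log (ρ w) - ρ w * Real.log (q w) + q w - ρ w)) ∂M :=
        integral_mono (hρi.sub hqi).abs ((hqi.const_mul _).add (hki.const_mul _))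
          fun w => kl_pointwise _ _ _ ENNReal.toReal_nonneg (hqpos w) hl
      _ = l * 1 + (1 + 1 / l) * ∫ w, (ρ w * Real.log (ρ w) - ρ w * Real.log (q w) + q w - ρ w) ∂M := by
        rw [integral_add (hqi.const_mul _) (hki.const_mul _), integral_const_mul,
          integral_const_mul, hq1]
      _ ≤ _ := by rw [mul_one]; gcongr
  -- characteristic functions
  set E : ℝ → ℂ := fun x => Complex.exp (t * x * Complex.I) with hE
  have hEn : ∀ x, ‖E x‖ = 1 := fun x => by
    have := Complex.norm_exp_ofReal_mul_I (t * x)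
    push_cast at this; exact this
  have hEm : Measurable E := by fun_prop
  have hmul : ∀ f : ℝ × ℝ → ℝ, Integrable f M → Integrable (fun w => f w • E w.1) M := by
    intro f hf
    refine hf.norm.mono' (hf.aestronglyMeasurable.smul (by fun_prop)) (ae_of_all _ fun w => ?_)
    rw [norm_smul, hEn, mul_one]
  have c1 : charFun (gaussianReal m v) t = ∫ w, ρ w • E w.1 ∂M := by
    rw [integral_rnDeriv_smul (μ := J) (ν := M) hac (f := fun w => E w.1), charFun_apply_real, ← hfst,
      integral_map measurable_fst.aemeasurable (by fun_prop)]
  have c2 : charFun ν t * Complex.exp (-(D * t ^ 2 / 2 : ℝ)) = ∫ w, q w • E w.1 ∂M := by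
    rw [hM, integral_prod_symm _ (hmul q hqi)]
    rw [charFun_apply_real, ← integral_mul_const]
    congr 1 with y
    have h1 := integral_withDensity_eq_integral_toReal_smul (μ := gaussianReal m v)
      (f := fun x => ENNReal.ofReal (q (x, y))) (by fun_prop) (ae_of_all _ fun _ => ENNReal.ofReal_lt_top) E
    simp only [hq] at h1
    rw [gaussian_eq_withDensity m v D r hv hD y] at h1
    have h2 := charFun_gaussianReal (μ := y) (v := D) t
    rw [charFun_apply_real] at h2
    simp only [hE] at h1
    rw [h2] at h1
    have h3 : ∀ x, (ENNReal.ofReal (qf m v D r x y)).toReal = qf m v D r x y :=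
      fun x => ENNReal.toReal_ofReal (hqpos (x, y)).le
    simp only [h3] at h1
    rw [← h1, ← Complex.exp_add]
    congr 1; push_cast; ring
  rw [c1, c2, ← integral_sub (hmul ρ hρi) (hmul q hqi)]
  refine (norm_integral_le_integral_norm _).trans (le_trans (le_of_eq ?_) htv)
  congr 1 with w
  rw [← sub_smul, norm_smul, hEn, mul_one, Real.norm_eq_abs]

lemma stmt_aux (μX σX : ℝ) (hσX : 0 < σX) (R Rc : ℝ≥0∞)
    (hR : 0 < R) (hRtop : R ≠ ⊤) (hRc : Rc ≠ ⊤)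
    (hcon : De (gauss μX σX) R Rc ≤ ENNReal.ofReal (σX ^ 2 * expNeg (2 * R))) : False := by
  set v : ℝ≥0 := ⟨σX ^ 2, sq_nonneg σX⟩ with hv
  have hvc : (v : ℝ) = σX ^ 2 := rfl
  have hv0 : (0:ℝ) < v := by rw [hvc]; positivity
  have hvne : v ≠ 0 := by intro h; rw [h] at hv0; simp at hv0
  set r := R.toReal with hr
  have hr0 : 0 < r := ENNReal.toReal_pos hR.ne' hRtop
  have hexp : expNeg (2 * R) = Real.exp (-(2 * r)) := by
    unfold expNeg
    rw [if_neg (ENNReal.mul_ne_top (by simp) hRtop)]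
    simp [hr]
  set D : ℝ≥0 := ⟨σX ^ 2 * Real.exp (-(2 * r)), by positivity⟩ with hDdef
  have hD : (D : ℝ) = v * Real.exp (-(2 * r)) := rfl
  have hD0 : (0:ℝ) < D := by rw [hD]; positivity
  have hDv : (D : ℝ) < v := by
    rw [hD]
    have : Real.exp (-(2 * r)) < 1 := by rw [Real.exp_lt_one_iff]; linarith
    nlinarith
  set H := R + Rc with hH
  have hHt : H ≠ ⊤ := by simp [hH, hRtop, hRc]
  set p := Real.exp (-H.toReal) / 2 with hp
  have hp0 : 0 < p := by positivity
  rw [hexp] at hcon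
  change De (gaussianReal μX v) R Rc ≤ ENNReal.ofReal D at hcon
  -- approximate optimisers
  have key : ∀ η : ℝ, 0 < η → ∃ ν : Measure ℝ, IsProbabilityMeasure ν ∧ (∃ y, p ≤ ν.real {y}) ∧
      ∀ t : ℝ, ‖charFun (gaussianReal μX v) t - charFun ν t * Complex.exp (-(D * t ^ 2 / 2 : ℝ))‖
      ≤ η := by
    intro η hη
    set l := η / 2 with hl
    have hl0 : 0 < l := by positivity
    set e := l / (1 + 1 / l) with he
    have he0 : 0 < e := by positivity
    have hlt : De (gaussianReal μX v) R Rc < ENNReal.ofReal (D * (1 + 2 * e)) := by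
      refine hcon.trans_lt ?_
      rw [ENNReal.ofReal_lt_ofReal_iff (by positivity)]
      nlinarith
    unfold De at hlt
    simp only [iInf_lt_iff] at hlt
    obtain ⟨J, ⟨hJp, hJf, hJI, hJH⟩, hJd⟩ := hlt
    refine ⟨J.map Prod.snd, Measure.isProbabilityMeasure_map measurable_snd.aemeasurable, ?_, ?_⟩
    · have : IsProbabilityMeasure (J.map Prod.snd) :=
        Measure.isProbabilityMeasure_map measurable_snd.aemeasurable
      refine exists_atom _ H hHt ?_
      unfold mutInfo at hJH
      rwa [Measure.map_map (by fun_prop) measurable_snd]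
    · intro t
      unfold mutInfo at hJI
      have hid : J.map (fun ω => (ω.1, ω.2)) = J := Measure.map_id
      rw [hid] at hJI
      refine (charFun_close μX v D r hvne hD J hJf R hRtop rfl hJI e l hl0 he0.le hJd.le t).trans ?_
      rw [he, mul_div_cancel₀ _ (by positivity)]
      linarith
  set κ : ℝ := (v - D) / 2 with hκ
  have hκ0 : 0 < κ := by rw [hκ]; linarith
  set F : ℕ → ℝ → ℝ := fun n t => min 1 (Real.exp (-(κ * (n * t) ^ 2)) +
    Real.exp (D * (n * t) ^ 2 / 2 - (n:ℝ) ^ 3)) with hF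
  have hFm : ∀ n, Measurable (F n) := fun n => by unfold F; fun_prop
  have hF0 : ∀ n t, 0 ≤ F n t := fun n t => by unfold F; positivity
  have hF1 : ∀ n t, F n t ≤ 1 := fun n t => min_le_left _ _
  have hlow : ∀ n, p ≤ ∫ t, F n t ∂(gaussianReal 0 1) := by
    intro n
    obtain ⟨ν, hν, ⟨y, hy⟩, hcf⟩ := key (Real.exp (-(n:ℝ)^3)) (Real.exp_pos _)
    refine hy.trans ((atom_le_charFun ν y n).trans ?_)
    refine integral_mono (Integrable.of_bound (C := 1) ?_ ?_) (Integrable.of_bound (C := 1)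
      (hFm n).aestronglyMeasurable (ae_of_all _ fun t => ?_)) fun t => ?_
    · have : Measurable (charFun ν) := measurable_charFun
      fun_prop
    · exact ae_of_all _ fun t => by simpa using norm_charFun_le_one _
    · rw [Real.norm_of_nonneg (hF0 _ _)]; exact hF1 _ _
    · refine le_min (norm_charFun_le_one _) ?_
      set u : ℝ := n * t with hu
      have h1 := hcf u
      have h2 : ‖charFun ν u * Complex.exp (-(D * u ^ 2 / 2 : ℝ))‖ ≤
          ‖charFun (gaussianReal μX v) u‖ + Real.exp (-(n:ℝ)^3) := by
        have := norm_sub_norm_le (charFun ν u * Complex.exp (-(D * u ^ 2 / 2 : ℝ)))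
          (charFun (gaussianReal μX v) u)
        rw [norm_sub_rev] at this
        linarith
      rw [norm_mul, charFun_gaussianReal, ← Complex.ofReal_neg, Complex.norm_exp, Complex.norm_exp,
        Complex.ofReal_re] at h2
      have h3 : (u * μX * Complex.I - v * u ^ 2 / 2 : ℂ).re = -(v * u ^ 2 / 2) := by
        have : (u * μX * Complex.I - v * u ^ 2 / 2 : ℂ) =
          ((-(v * u ^ 2 / 2) : ℝ) : ℂ) + ((u * μX : ℝ) : ℂ) * Complex.I := by
          push_cast; ring
        rw [this, Complex.add_re, Complex.re_ofReal_mul, Complex.ofReal_re, Complex.I_re]; ring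
      rw [h3] at h2
      have h4 := mul_le_mul_of_nonneg_right h2 (Real.exp_pos (D * u ^ 2 / 2)).le
      rw [mul_assoc, add_mul, ← Real.exp_add, ← Real.exp_add, ← Real.exp_add, neg_add_cancel,
        Real.exp_zero, mul_one] at h4
      refine h4.trans (le_of_eq ?_)
      congr 2
      · rw [hκ]; ring
      · ring
  have hlim : Filter.Tendsto (fun n => ∫ t, F n t ∂(gaussianReal 0 1)) Filter.atTop
      (nhds (∫ t, (0:ℝ) ∂(gaussianReal 0 1))) := by
    refine tendsto_integral_of_dominated_convergence (fun _ => (1:ℝ))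
      (fun n => (hFm n).aestronglyMeasurable) (integrable_const _) (fun n => ae_of_all _ fun t => ?_) ?_
    · rw [Real.norm_of_nonneg (hF0 _ _)]; exact hF1 _ _
    · have hna : ∀ᵐ t ∂(gaussianReal 0 1), t ≠ 0 := by
        have := nullSingletonClass_gaussianReal (μ := 0) (v := 1) one_ne_zero
        rw [ae_iff]; simp
      filter_upwards [hna] with t ht
      have hn : Filter.Tendsto (fun n : ℕ => (n:ℝ)) Filter.atTop Filter.atTop := tendsto_natCast_atTop_atTop
      have hn2 : Filter.Tendsto (fun n : ℕ => (n:ℝ)^2) Filter.atTop Filter.atTop :=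
        (Filter.tendsto_pow_atTop two_ne_zero).comp hn
      have t1 : Filter.Tendsto (fun n : ℕ => Real.exp (-(κ * (n * t) ^ 2))) Filter.atTop (nhds 0) := by
        refine Real.tendsto_exp_neg_atTop_nhds_zero.comp ?_
        have := hn2.const_mul_atTop (show 0 < κ * t ^ 2 by positivity)
        refine this.congr fun n => ?_
        ring
      have t2 : Filter.Tendsto (fun n : ℕ => Real.exp (D * (n * t) ^ 2 / 2 - (n:ℝ) ^ 3)) Filter.atTop (nhds 0) := by
        have h5 : Filter.Tendsto (fun n : ℕ => (n:ℝ)^2 * ((n:ℝ) - D * t ^ 2 / 2)) Filter.atTop Filter.atTop :=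
          hn2.atTop_mul_atTop₀ (Filter.tendsto_atTop_add_const_right _ _ hn)
        refine (Real.tendsto_exp_neg_atTop_nhds_zero.comp h5).congr fun n => ?_
        simp only [Function.comp]
        congr 1; ring
      have t3 := t1.add t2
      rw [add_zero] at t3
      exact squeeze_zero (fun n => hF0 n t) (fun n => min_le_right _ _) t3
  have := ge_of_tendsto' hlim hlow
  simp at this
  linarith

/-- `D_e(R, R_c) > σ_X² e^{-2R}` for Gaussian sources, `R ∈ (0,∞)`, `R_c ∈ [0,∞)`. -/
theorem stmt17 (μX σX : ℝ) (hσX : 0 < σX) (R Rc : ℝ≥0∞)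
    (hR : 0 < R) (hRtop : R ≠ ⊤) (hRc : Rc ≠ ⊤) :
    De (gauss μX σX) R Rc > ENNReal.ofReal (σX ^ 2 * expNeg (2 * R)) := by
  by_contra h
  exact stmt_aux μX σX hσX R Rc hR hRtop hRc (not_lt.1 h)
end
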